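/- For every integer n ≥ 2, every non-zero point u in ℝ^n and every δ > 0, there exist q₀ ∈ δℤ with q₀ ≥ 0 and a rigid n-system P of mesh δ on [q₀,∞) such that the difference P − L_u is bounded on [q₀,∞). -/

import Mathlib

open Set Filter

noncomputable section

/-- An `n`-system on the interval `I` (conditions (S1)–(S3)). -/
def IsNSystem (n : ℕ) (I : Set ℝ) (P : ℝ → Fin n → ℝ) : Prop :=
  ∀ q ∈ I,
    ((∀ i, 0 ≤ P q i) ∧ Monotone (P q) ∧ (∑ i, P q i) = q) ∧
    ∃ ε > 0, ∃ k ℓ : Fin n,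
      (∀ t ∈ I ∩ Icc (q - ε) q, P t = P q + Pi.single ℓ (t - q)) ∧
      (∀ t ∈ I ∩ Icc q (q + ε), P t = P q + Pi.single k (t - q)) ∧
      (q ∈ interior I → ℓ < k → ∀ i, ℓ ≤ i → i ≤ k → P q i = P q ℓ)

/-- A rigid `n`-system of mesh `δ` on `[q₀,∞)`. -/
def IsRigid (n : ℕ) (δ q₀ : ℝ) (P : ℝ → Fin n → ℝ) : Prop :=
  (∃ m : ℤ, q₀ = δ * m) ∧
  (∀ q, q₀ ≤ q → (∃ m : ℤ, q = δ * m) → ∀ i, ∃ m : ℤ, P q i = δ * m) ∧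
  Function.Injective (P q₀) ∧
  ∀ q, q₀ < q → (∀ m : ℤ, q ≠ δ * m) → Function.Injective (P q)

open scoped RealInnerProductSpace

/-- `log`-free `i`-th successive minimum of the convex body
`C_u(q) = {x : ‖x‖ ≤ 1, |x·u| ≤ e^{-q}}` with respect to `ℤ^n`. -/
def lamMin (n : ℕ) (u : EuclideanSpace ℝ (Fin n)) (q : ℝ) (i : ℕ) : ℝ :=
  sInf {lam : ℝ | 1 ≤ lam ∧ ∃ v : Fin i → EuclideanSpace ℝ (Fin n),
    LinearIndependent ℝ v ∧ ∀ j, (∀ k, ∃ m : ℤ, v j k = (m : ℝ)) ∧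
      ‖v j‖ ≤ lam ∧ |⟪v j, u⟫| ≤ lam * Real.exp (-q)}

/-- The map `L_u(q) = (log λ₁(q), …, log λₙ(q))`. -/
def Lu (n : ℕ) (u : EuclideanSpace ℝ (Fin n)) (q : ℝ) : Fin n → ℝ :=
  fun i => Real.log (lamMin n u q ((i : ℕ) + 1))


/-- The piecewise linear path attached to a discrete sequence of integer points. -/
def pathOf (n : ℕ) (δ : ℝ) (T0 : ℕ) (a : ℕ → Fin n → ℕ) (k : ℕ → Fin n) (q : ℝ) : Fin n → ℝ :=
  (fun i => δ * (a (⌊q / δ⌋₊ - T0) i : ℝ)) +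
    Pi.single (k (⌊q / δ⌋₊ - T0)) (q - δ * ((T0 + (⌊q / δ⌋₊ - T0) : ℕ) : ℝ))

theorem pathOf_ico (n : ℕ) (δ : ℝ) (hδ : 0 < δ) (T0 : ℕ) (a : ℕ → Fin n → ℕ) (k : ℕ → Fin n)
    (T : ℕ) (q : ℝ) (h1 : δ * ((T0 + T : ℕ) : ℝ) ≤ q) (h2 : q < δ * ((T0 + T + 1 : ℕ) : ℝ)) :
    pathOf n δ T0 a k q =
      (fun i => δ * (a T i : ℝ)) + Pi.single (k T) (q - δ * ((T0 + T : ℕ) : ℝ)) := by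
  have hf : ⌊q / δ⌋₊ = T0 + T := by
    have h0 : (0 : ℝ) ≤ q / δ := div_nonneg (le_trans (by positivity) h1) hδ.le
    rw [Nat.floor_eq_iff h0]
    constructor
    · rw [le_div_iff₀ hδ, mul_comm]; exact h1
    · rw [div_lt_iff₀ hδ, mul_comm]; push_cast at h2 ⊢; exact h2
  unfold pathOf
  rw [hf]
  simp

theorem pathOf_icc (n : ℕ) (δ : ℝ) (hδ : 0 < δ) (T0 : ℕ) (a : ℕ → Fin n → ℕ) (k : ℕ → Fin n)
    (hstep : ∀ T, a (T + 1) = a T + Pi.single (k T) 1)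
    (T : ℕ) (q : ℝ) (h1 : δ * ((T0 + T : ℕ) : ℝ) ≤ q) (h2 : q ≤ δ * ((T0 + T + 1 : ℕ) : ℝ)) :
    pathOf n δ T0 a k q =
      (fun i => δ * (a T i : ℝ)) + Pi.single (k T) (q - δ * ((T0 + T : ℕ) : ℝ)) := by
  rcases h2.lt_or_eq with h | h
  · exact pathOf_ico n δ hδ T0 a k T q h1 h
  · have := pathOf_ico n δ hδ T0 a k (T + 1) q (by rw [h]; push_cast; linarith)
      (by rw [h]; push_cast; nlinarith)
    rw [this, hstep, h]
    funext i
    by_cases hi : i = k T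
    · subst hi
      by_cases h' : k T = k (T + 1)
      · simp [h']; ring
      · simp [h']; ring
    · by_cases h' : i = k (T + 1)
      · subst h'; simp [hi]; ring
      · simp [hi, h']

/-- A discrete sequence of points yields a rigid system. -/
theorem rigid_of_seq (n : ℕ) (δ : ℝ) (hδ : 0 < δ) (T0 : ℕ) (a : ℕ → Fin n → ℕ) (k : ℕ → Fin n)
    (hstep : ∀ T, a (T + 1) = a T + Pi.single (k T) 1)
    (hsum : ∑ i, a 0 i = T0)
    (h0 : StrictMono (a 0))
    (hsep : ∀ T i j, i < j → a T i < a T j ∨ (a T i = a T j ∧ j = k T))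
    (hS3 : ∀ T, k T < k (T + 1) → ∀ i, k T ≤ i → i ≤ k (T + 1) → a (T + 1) i = a (T + 1) (k T)) :
    IsNSystem n (Ici (δ * (T0 : ℝ))) (pathOf n δ T0 a k) ∧
      IsRigid n δ (δ * (T0 : ℝ)) (pathOf n δ T0 a k) ∧
      ∀ q, δ * (T0 : ℝ) ≤ q → ∃ T : ℕ, δ * ((T0 + T : ℕ) : ℝ) ≤ q ∧
        q ≤ δ * ((T0 + T + 1 : ℕ) : ℝ) ∧
        ∀ i, δ * (a T i : ℝ) ≤ pathOf n δ T0 a k q i ∧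
          pathOf n δ T0 a k q i ≤ δ * (a T i : ℝ) + δ := by
  have hT : ∀ q, δ * (T0 : ℝ) ≤ q → ∃ T : ℕ, δ * ((T0 + T : ℕ) : ℝ) ≤ q ∧
        q < δ * ((T0 + T + 1 : ℕ) : ℝ) := by
    intro q hq
    have hq0 : 0 ≤ q / δ := div_nonneg (le_trans (by positivity) hq) hδ.le
    have hle : T0 ≤ ⌊q / δ⌋₊ := by
      apply Nat.le_floor
      rw [le_div_iff₀ hδ, mul_comm]; exact hq
    refine ⟨⌊q / δ⌋₊ - T0, ?_, ?_⟩
    · rw [Nat.add_sub_cancel' hle, mul_comm, ← le_div_iff₀ hδ]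
      exact Nat.floor_le hq0
    · rw [Nat.add_sub_cancel' hle, mul_comm, ← div_lt_iff₀ hδ]
      push_cast
      exact Nat.lt_floor_add_one _
  have hsumT : ∀ T, ∑ i, a T i = T0 + T := by
    intro T
    induction T with
    | zero => simpa using hsum
    | succ T ih =>
      rw [hstep]
      simp [Finset.sum_add_distrib, ih]
      ring
  -- strictness of the interpolated points
  have hmono : ∀ T, ∀ t : ℝ, 0 ≤ t → t ≤ δ →
      Monotone ((fun i => δ * (a T i : ℝ)) + Pi.single (k T) t : Fin n → ℝ) := by
    intro T t ht0 ht1 i j hij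
    rcases hij.lt_or_eq with hij | hij
    · rcases hsep T i j hij with h | ⟨h, hj⟩
      · have h' : (a T i : ℝ) + 1 ≤ a T j := by exact_mod_cast h
        have h2 : δ * (a T i : ℝ) + δ ≤ δ * a T j := by nlinarith
        have e1 : (Pi.single (k T) t : Fin n → ℝ) i ≤ δ := by
          by_cases hi : i = k T
          · subst hi; simpa using ht1
          · simp [hi, hδ.le]
        have e2 : 0 ≤ (Pi.single (k T) t : Fin n → ℝ) j := by
          by_cases hi : j = k T
          · subst hi; simpa using ht0
          · simp [hi]
        simp only [Pi.add_apply]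
        linarith
      · have hi : i ≠ k T := by rw [← hj]; exact hij.ne
        simp only [Pi.add_apply]
        rw [h, hj]
        simp [hi, ht0]
    · rw [hij]
  have hinj : ∀ T, ∀ t : ℝ, 0 < t → t < δ →
      StrictMono ((fun i => δ * (a T i : ℝ)) + Pi.single (k T) t : Fin n → ℝ) := by
    intro T t ht0 ht1 i j hij
    rcases hsep T i j hij with h | ⟨h, hj⟩
    · have h' : (a T i : ℝ) + 1 ≤ a T j := by exact_mod_cast h
      have h2 : δ * (a T i : ℝ) + δ ≤ δ * a T j := by nlinarith
      have e1 : (Pi.single (k T) t : Fin n → ℝ) i < δ := by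
        by_cases hi : i = k T
        · subst hi; simpa using ht1
        · simp [hi, hδ]
      have e2 : 0 ≤ (Pi.single (k T) t : Fin n → ℝ) j := by
        by_cases hi : j = k T
        · subst hi; simpa using ht0.le
        · simp [hi]
      simp only [Pi.add_apply]
      linarith
    · have hi : i ≠ k T := by rw [← hj]; exact hij.ne
      simp only [Pi.add_apply]
      rw [h, hj]
      simp [hi, ht0]
  have hform := pathOf_icc n δ hδ T0 a k hstep
  refine ⟨?_, ⟨⟨T0, by simp⟩, ?_, ?_, ?_⟩, ?_⟩
  · intro q hq
    obtain ⟨T, hT1, hT2⟩ := hT q hq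
    have hPq := hform T q hT1 hT2.le
    have hd : δ * ((T0 + T + 1 : ℕ) : ℝ) = δ * ((T0 + T : ℕ) : ℝ) + δ := by push_cast; ring
    refine ⟨⟨?_, ?_, ?_⟩, ?_⟩
    · intro i
      rw [hPq]
      simp only [Pi.add_apply]
      have : 0 ≤ (Pi.single (k T) (q - δ * ((T0 + T : ℕ) : ℝ)) : Fin n → ℝ) i := by
        by_cases hi : i = k T
        · subst hi; simp only [Pi.single_eq_same]; linarith
        · simp [hi]
      positivity
    · rw [hPq]
      exact hmono T _ (by linarith) (by linarith)
    · rw [hPq]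
      simp only [Pi.add_apply, Finset.sum_add_distrib, ← Finset.mul_sum]
      have : (∑ i, (a T i : ℝ)) = ((T0 + T : ℕ) : ℝ) := by exact_mod_cast hsumT T
      rw [this]
      simp
    · -- right side
      have hright : ∀ t, q ≤ t → t ≤ δ * ((T0 + T + 1 : ℕ) : ℝ) →
          pathOf n δ T0 a k t = pathOf n δ T0 a k q + Pi.single (k T) (t - q) := by
        intro t ht1 ht2
        rw [hform T t (hT1.trans ht1) ht2, hPq, add_assoc, ← Pi.single_add]
        congr 2; ring
      rcases hT1.lt_or_eq with hlt | heq
      · refine ⟨min (q - δ * ((T0 + T : ℕ) : ℝ)) (δ * ((T0 + T + 1 : ℕ) : ℝ) - q),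
          lt_min (by linarith) (by linarith), k T, k T, ?_, ?_, fun _ h => absurd h (lt_irrefl _)⟩
        · rintro t ⟨-, ht1, ht2⟩
          have := min_le_left (q - δ * ((T0 + T : ℕ) : ℝ)) (δ * ((T0 + T + 1 : ℕ) : ℝ) - q)
          rw [hform T t (by linarith) (by linarith), hPq, add_assoc, ← Pi.single_add]
          congr 2; ring
        · rintro t ⟨-, ht1, ht2⟩
          have := min_le_right (q - δ * ((T0 + T : ℕ) : ℝ)) (δ * ((T0 + T + 1 : ℕ) : ℝ) - q)
          exact hright t ht1 (by linarith)
      · cases T with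
        | zero =>
          refine ⟨δ, hδ, k 0, k 0, ?_, ?_, fun _ h => absurd h (lt_irrefl _)⟩
          · rintro t ⟨ht, ht1, ht2⟩
            have : t = q := by
              apply le_antisymm ht2
              rw [← heq]
              simpa using ht
            rw [this]; simp
          · rintro t ⟨-, ht1, ht2⟩
            exact hright t ht1 (by linarith)
        | succ T =>
          refine ⟨δ, hδ, k (T + 1), k T, ?_, ?_, ?_⟩
          · rintro t ⟨-, ht1, ht2⟩
            have e1 : δ * ((T0 + (T + 1) : ℕ) : ℝ) = δ * ((T0 + T : ℕ) : ℝ) + δ := by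
              push_cast; ring
            have e2 : δ * ((T0 + T + 1 : ℕ) : ℝ) = δ * ((T0 + T : ℕ) : ℝ) + δ := by
              push_cast; ring
            rw [hform T t (by linarith) (by linarith), hform T q (by linarith) (by linarith),
              add_assoc, ← Pi.single_add]
            congr 2; ring
          · rintro t ⟨-, ht1, ht2⟩
            exact hright t ht1 (by linarith)
          · intro _ hlt i hi1 hi2
            have : ∀ i, pathOf n δ T0 a k q i = δ * (a (T + 1) i : ℝ) := by
              intro i
              rw [hPq, ← heq]; simp
            rw [this, this, hS3 T hlt i hi1 hi2]
  · rintro q hq ⟨m, hm⟩ i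
    obtain ⟨T, hT1, hT2⟩ := hT q hq
    have hq' : q = δ * ((T0 + T : ℕ) : ℝ) := by
      have h1 : ((T0 + T : ℕ) : ℝ) ≤ (m : ℝ) := by
        rw [hm] at hT1; exact le_of_mul_le_mul_left hT1 hδ
      have h2 : (m : ℝ) < ((T0 + T + 1 : ℕ) : ℝ) := by
        rw [hm] at hT2; exact lt_of_mul_lt_mul_left hT2 hδ.le
      have h3 : ((T0 + T : ℕ) : ℤ) ≤ m := by exact_mod_cast h1
      have h4 : m < ((T0 + T + 1 : ℕ) : ℤ) := by exact_mod_cast h2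
      have h5 : m = ((T0 + T : ℕ) : ℤ) := by push_cast at *; omega
      rw [hm, h5]; push_cast; ring
    refine ⟨a T i, ?_⟩
    rw [hform T q hT1 hT2.le, hq']
    simp
  · have := hform 0 (δ * T0) (by simp) (by push_cast; nlinarith)
    rw [this]
    intro i j hij
    simp [hδ.ne'] at hij
    exact h0.injective hij
  · intro q hq hm
    obtain ⟨T, hT1, hT2⟩ := hT q hq.le
    rw [hform T q hT1 hT2.le]
    apply (hinj T _ _ _).injective
    · rcases hT1.lt_or_eq with h | h
      · linarith
      · exact absurd h.symm (by have := hm ((T0 + T : ℕ) : ℤ); push_cast at this ⊢; exact this)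
    · push_cast at hT2 ⊢; linarith
  · intro q hq
    obtain ⟨T, hT1, hT2⟩ := hT q hq
    refine ⟨T, hT1, hT2.le, fun i => ?_⟩
    rw [hform T q hT1 hT2.le]
    have hd : δ * ((T0 + T + 1 : ℕ) : ℝ) = δ * ((T0 + T : ℕ) : ℝ) + δ := by push_cast; ring
    by_cases hi : i = k T
    · subst hi
      simp only [Pi.add_apply, Pi.single_eq_same]
      constructor <;> linarith
    · simp [hi, hδ.le]

/-- Position of the `i`-th particle given the cumulative counting function `c`. -/
def posOf (c : ℕ → ℕ) (i : ℕ) : ℕ := sInf {z | i < c z}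

theorem lt_posOf_iff {c : ℕ → ℕ} (hc : Monotone c) {i : ℕ} (h : ∃ z, i < c z) (z : ℕ) :
    z < posOf c i ↔ c z ≤ i := by
  have hmem : i < c (posOf c i) := Nat.sInf_mem (s := {z | i < c z}) h
  constructor
  · intro hz
    by_contra hcon
    exact absurd (Nat.sInf_le (s := {z | i < c z}) (show z ∈ {z | i < c z} from not_le.mp hcon))
      (not_le.mpr hz)
  · intro hz
    by_contra hcon
    exact absurd (hc (not_lt.mp hcon)) (by omega)

theorem posOf_eq {c : ℕ → ℕ} {i w : ℕ} (h1 : i < c w)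
    (h2 : ∀ z, z < w → c z ≤ i) : posOf c i = w := by
  apply le_antisymm
  · exact Nat.sInf_le (s := {z | i < c z}) h1
  · by_contra hcon
    have := h2 _ (not_le.mp hcon)
    have hmem : i < c (posOf c i) := Nat.sInf_mem (s := {z | i < c z}) ⟨w, h1⟩
    omega

/-- The fine sequence of decrements gives a rigid system. -/
theorem rigid_of_fine (n : ℕ) (δ : ℝ) (hδ : 0 < δ) (c : ℕ → ℕ → ℕ) (z : ℕ → ℕ)
    (hmono : ∀ T, Monotone (c T)) (hn : ∀ T w, c T w ≤ n) (hev : ∀ T, ∃ w, c T w = n)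
    (hzero : ∀ T, c T 0 = 0)
    (hdec : ∀ T, c T (z T) = c (T + 1) (z T) + 1)
    (hsame : ∀ T w, w ≠ z T → c T w = c (T + 1) w)
    (hz : ∀ T, z (T + 1) ≤ z T + 1)
    (hjump : ∀ T w, w + 1 ≠ z T → c T (w + 1) ≤ c T w + 1)
    (hjump2 : ∀ T w, w + 1 = z T → c T (w + 1) ≤ c T w + 2)
    (hjump0 : ∀ w, c 0 (w + 1) ≤ c 0 w + 1) :
    ∃ P : ℝ → Fin n → ℝ, ∃ T0 : ℕ, (T0 = ∑ i : Fin n, posOf (c 0) i) ∧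
      IsNSystem n (Ici (δ * (T0 : ℝ))) P ∧
      IsRigid n δ (δ * (T0 : ℝ)) P ∧
      (∀ T, ∑ i : Fin n, posOf (c T) i = T0 + T) ∧
      (∀ T (i : Fin n), posOf (c T) i ≤ posOf (c (T + 1)) i ∧
        posOf (c (T + 1)) i ≤ posOf (c T) i + 1) ∧
      ∀ q, δ * (T0 : ℝ) ≤ q → ∃ T : ℕ, δ * ((T0 + T : ℕ) : ℝ) ≤ q ∧
        q ≤ δ * ((T0 + T + 1 : ℕ) : ℝ) ∧
        ∀ i : Fin n, δ * (posOf (c T) i : ℝ) ≤ P q i ∧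
          P q i ≤ δ * (posOf (c T) i : ℝ) + δ := by
  have hex : ∀ T (i : Fin n), ∃ w, (i : ℕ) < c T w := by
    intro T i
    obtain ⟨w, hw⟩ := hev T
    exact ⟨w, by rw [hw]; exact i.2⟩
  have hlt : ∀ T (i : Fin n) w, w < posOf (c T) i ↔ c T w ≤ i :=
    fun T i w => lt_posOf_iff (hmono T) (hex T i) w
  have hkk : ∀ T, c T (z T) - 1 < n := fun T => by
    have := hn T (z T); have := hdec T; omega
  let k : ℕ → Fin n := fun T => ⟨c T (z T) - 1, hkk T⟩
  have hkv : ∀ T, ((k T : Fin n) : ℕ) = c T (z T) - 1 := fun T => rfl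
  let a : ℕ → Fin n → ℕ := fun T i => posOf (c T) i
  have hak : ∀ T, a T (k T) = z T := by
    intro T
    apply posOf_eq
    · rw [hkv]; have := hdec T; omega
    · intro w hw
      rw [hkv, hsame T w hw.ne]
      have := hmono (T + 1) hw.le
      have := hdec T; omega
  have hak' : ∀ T, a (T + 1) (k T) = z T + 1 := by
    intro T
    apply posOf_eq
    · rw [hkv]
      rw [← hsame T (z T + 1) (by omega)]
      have := hmono T (Nat.le_succ (z T))
      have := hdec T
      simp only [Nat.succ_eq_add_one] at *
      omega
    · intro w hw
      rw [hkv]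
      have := hmono (T + 1) (Nat.lt_succ_iff.mp hw)
      have := hdec T; omega
  have hother : ∀ T i, i ≠ k T → a (T + 1) i = a T i := by
    intro T i hi
    have hne : (i : ℕ) ≠ c T (z T) - 1 := fun h => hi (Fin.ext h)
    have key : ∀ w, w < a (T + 1) i ↔ w < a T i := by
      intro w
      change w < posOf (c (T + 1)) i ↔ w < posOf (c T) i
      rw [hlt, hlt]
      by_cases hw : w = z T
      · subst hw; have := hdec T; omega
      · rw [hsame T w hw]
    have h1 := key (a T i)
    have h2 := key (a (T + 1) i)
    simp only [lt_irrefl, iff_false, false_iff] at h1 h2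
    omega
  have hstep : ∀ T, a (T + 1) = a T + Pi.single (k T) 1 := by
    intro T
    funext i
    by_cases hi : i = k T
    · subst hi; simp [hak, hak']
    · simp [hi, hother T i hi]
  have hsep : ∀ T i j, i < j → a T i < a T j ∨ (a T i = a T j ∧ j = k T) := by
    intro T i j hij
    have hij' : (i : ℕ) < j := hij
    have hle : a T i ≤ a T j := by
      by_contra hcon
      have h1 := (hlt T i _).mp (not_le.mp hcon)
      have h2 := (hlt T j (a T j)).not.mp (lt_irrefl _)
      omega
    rcases hle.lt_or_eq with h | h
    · exact Or.inl h
    · refine Or.inr ⟨h, ?_⟩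
      have h2 := (hlt T j (a T j)).not.mp (lt_irrefl _)
      have hpos : a T j ≠ 0 := by
        intro h0; rw [h0, hzero] at h2; omega
      obtain ⟨w, hw⟩ := Nat.exists_eq_succ_of_ne_zero hpos
      have h3 := (hlt T i w).mp (by change w < a T i; omega)
      have hwz : w + 1 = z T := by
        by_contra hcon
        have := hjump T w hcon
        rw [hw] at h2
        simp only [Nat.succ_eq_add_one] at *
        omega
      have := hjump2 T w hwz
      rw [hw] at h2
      apply Fin.ext
      rw [hkv, ← hwz]
      simp only [Nat.succ_eq_add_one] at *
      omega
  have h0 : StrictMono (a 0) := by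
    intro i j hij
    rcases hsep 0 i j hij with h | ⟨h, hj⟩
    · exact h
    · exfalso
      have hij' : (i : ℕ) < j := hij
      have h2 := (hlt 0 j (a 0 j)).not.mp (lt_irrefl _)
      have hpos : a 0 j ≠ 0 := by
        intro h0; rw [h0, hzero] at h2; omega
      obtain ⟨w, hw⟩ := Nat.exists_eq_succ_of_ne_zero hpos
      have h3 := (hlt 0 i w).mp (by change w < a 0 i; omega)
      have := hjump0 w
      rw [hw] at h2
      simp only [Nat.succ_eq_add_one] at *
      omega
  have hS3 : ∀ T, k T < k (T + 1) → ∀ i, k T ≤ i → i ≤ k (T + 1) →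
      a (T + 1) i = a (T + 1) (k T) := by
    intro T hlt' i hi1 hi2
    have hm : ∀ i j, i ≤ j → a (T + 1) i ≤ a (T + 1) j := by
      intro i j hij
      rcases hij.lt_or_eq with h | h
      · rcases hsep (T + 1) i j h with h | h
        · exact h.le
        · exact h.1.le
      · rw [h]
    have h1 := hm _ _ hi1
    have h2 := hm _ _ hi2
    have h3 := hak (T + 1)
    have h4 := hak' T
    have := hz T
    omega
  obtain ⟨hA, hB, hC⟩ := rigid_of_seq n δ hδ (∑ i, a 0 i) a k hstep rfl h0 hsep hS3
  refine ⟨_, _, rfl, hA, hB, ?_, ?_, hC⟩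
  · intro T
    change ∑ i, a T i = _
    induction T with
    | zero => rfl
    | succ T ih =>
      rw [hstep]
      simp only [Pi.add_apply, Finset.sum_add_distrib, ih]
      simp
      rfl
  · intro T i
    change a T i ≤ a (T + 1) i ∧ a (T + 1) i ≤ a T i + 1
    rw [hstep]
    by_cases hi : i = k T
    · subst hi; simp
    · simp [hi]

/-- State of the fine process: index of the current jump and current position. -/
def fineState (x y : ℕ → ℕ) : ℕ → ℕ × ℕ
  | 0 => (0, x 0)
  | T + 1 =>
    let st := fineState x y T
    if st.2 + 1 < y st.1 then (st.1, st.2 + 1) else (st.1 + 1, x (st.1 + 1))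

theorem rigid_of_jumps (n : ℕ) (δ : ℝ) (hδ : 0 < δ) (c : ℕ → ℕ → ℕ) (x y : ℕ → ℕ) (Y : ℕ)
    (hmono : ∀ s, Monotone (c s)) (hn : ∀ s w, c s w ≤ n) (hev : ∀ s, ∃ w, c s w = n)
    (hzero : ∀ s, c s 0 = 0)
    (hxy : ∀ s, x s < y s) (hxY : ∀ s, y s ≤ x s + Y)
    (hin : ∀ s w, x s ≤ w → w < y s → c s w = c (s + 1) w + 1)
    (hlo : ∀ s w, w < x s → c s w = c (s + 1) w)
    (hhi : ∀ s w, y s ≤ w → c s w = c (s + 1) w)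
    (hyx : ∀ s, x (s + 1) ≤ y s)
    (hjump : ∀ s w, c s (w + 1) ≤ c s w + 1) :
    ∃ P : ℝ → Fin n → ℝ, ∃ T0 : ℕ,
      IsNSystem n (Ici (δ * (T0 : ℝ))) P ∧
      IsRigid n δ (δ * (T0 : ℝ)) P ∧
      ∀ q, δ * (T0 : ℝ) ≤ q → ∃ s : ℕ,
        |q - δ * ((∑ i : Fin n, posOf (c s) i : ℕ) : ℝ)| ≤ δ * (Y + 1) ∧
        ∀ i : Fin n, |P q i - δ * (posOf (c s) i : ℝ)| ≤ δ * (Y + 1) := by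
  let F := fineState x y
  let C : ℕ → ℕ → ℕ := fun T w => if w < (F T).2 then c ((F T).1 + 1) w else c (F T).1 w
  have hF1 : ∀ T, (F T).2 + 1 < y (F T).1 → F (T + 1) = ((F T).1, (F T).2 + 1) := by
    intro T h
    change fineState x y (T + 1) = _
    simp only [fineState]
    exact if_pos h
  have hF2 : ∀ T, ¬ (F T).2 + 1 < y (F T).1 → F (T + 1) = ((F T).1 + 1, x ((F T).1 + 1)) := by
    intro T h
    change fineState x y (T + 1) = _
    simp only [fineState]
    exact if_neg h
  have hinv : ∀ T, x (F T).1 ≤ (F T).2 ∧ (F T).2 < y (F T).1 := by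
    intro T
    induction T with
    | zero => exact ⟨le_rfl, hxy 0⟩
    | succ T ih =>
      by_cases h : (F T).2 + 1 < y (F T).1
      · rw [hF1 T h]
        exact ⟨ih.1.trans (Nat.le_succ _), h⟩
      · rw [hF2 T h]
        exact ⟨le_rfl, hxy _⟩
  have hle : ∀ s w, c (s + 1) w ≤ c s w := by
    intro s w
    by_cases h1 : w < x s
    · rw [hlo s w h1]
    · by_cases h2 : w < y s
      · rw [hin s w (by omega) h2]; omega
      · rw [hhi s w (by omega)]
  have hle1 : ∀ s w, c s w ≤ c (s + 1) w + 1 := by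
    intro s w
    by_cases h1 : w < x s
    · rw [hlo s w h1]; omega
    · by_cases h2 : w < y s
      · rw [hin s w (by omega) h2]
      · rw [hhi s w (by omega)]; omega
  have hstart : ∀ T, (F T).2 = x (F T).1 → C T = c (F T).1 := by
    intro T hT
    funext w
    simp only [C]
    split_ifs with h
    · exact (hlo _ w (by omega)).symm
    · rfl
  -- description of a step
  have hC1 : ∀ T w, C (T + 1) w = if w < (F T).2 + 1 then c ((F T).1 + 1) w else c (F T).1 w := by
    intro T w
    by_cases h : (F T).2 + 1 < y (F T).1
    · have e : F (T + 1) = ((F T).1, (F T).2 + 1) := hF1 T h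
      simp only [C, e]
    · have e : F (T + 1) = ((F T).1 + 1, x ((F T).1 + 1)) := hF2 T h
      have h' : (F T).2 + 1 = y (F T).1 := by have := (hinv T).2; omega
      rw [hstart (T + 1) (by rw [e]), e]
      split_ifs with h3
      · rfl
      · exact (hhi _ w (by omega)).symm
  have hnear : ∀ T, ∃ T' s, T' ≤ T ∧ T = T' + ((F T).2 - x (F T).1) ∧ C T' = c s := by
    intro T
    induction T with
    | zero => exact ⟨0, 0, le_rfl, by change 0 = 0 + (x 0 - x 0); omega, hstart 0 rfl⟩
    | succ T ih =>
      by_cases h : (F T).2 + 1 < y (F T).1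
      · have e : F (T + 1) = ((F T).1, (F T).2 + 1) := hF1 T h
        obtain ⟨T', s, h1, h2, h3⟩ := ih
        refine ⟨T', s, by omega, ?_, h3⟩
        rw [e]
        have := (hinv T).1
        dsimp only
        omega
      · have e : F (T + 1) = ((F T).1 + 1, x ((F T).1 + 1)) := hF2 T h
        refine ⟨T + 1, (F T).1 + 1, le_rfl, by rw [e]; simp, ?_⟩
        rw [hstart (T + 1) (by rw [e]), e]
  obtain ⟨P, T0, hT0, hA, hB, hsum, hinc, hC⟩ := rigid_of_fine n δ hδ C (fun T => (F T).2)
    (by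
      intro T
      apply monotone_nat_of_le_succ
      intro w
      simp only [C]
      split_ifs with h1 h2
      · exact hmono _ (Nat.le_succ w)
      · exact (hmono _ (Nat.le_succ w)).trans (hle _ _)
      · omega
      · exact hmono _ (Nat.le_succ w))
    (by intro T w; simp only [C]; split_ifs <;> exact hn _ _)
    (by
      intro T
      obtain ⟨w, hw⟩ := hev (F T).1
      refine ⟨max w (F T).2, ?_⟩
      simp only [C]
      rw [if_neg (by omega)]
      have := hmono (F T).1 (le_max_left w (F T).2)
      have := hn (F T).1 (max w (F T).2)
      omega)
    (by intro T; simp only [C]; split_ifs <;> exact hzero _)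
    (by
      intro T
      rw [hC1, if_pos (by omega)]
      simp only [C]
      rw [if_neg (by omega)]
      exact hin _ _ (hinv T).1 (hinv T).2)
    (by
      intro T w hw
      rw [hC1]
      simp only [C]
      split_ifs <;> first | rfl | omega)
    (by
      intro T
      change (F (T + 1)).2 ≤ (F T).2 + 1
      by_cases h : (F T).2 + 1 < y (F T).1
      · have e : F (T + 1) = ((F T).1, (F T).2 + 1) := hF1 T h
        rw [e]
      · have e : F (T + 1) = ((F T).1 + 1, x ((F T).1 + 1)) := hF2 T h
        rw [e]
        have := hyx (F T).1
        have := (hinv T).2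
        dsimp only
        omega)
    (by
      intro T w hw
      simp only [C]
      have h1 := hjump (F T).1 w
      have h2 := hjump ((F T).1 + 1) w
      split_ifs <;> omega)
    (by
      intro T w hw
      simp only [C]
      have h1 := hjump (F T).1 w
      have h2 := hle1 (F T).1 w
      split_ifs <;> omega)
    (by
      intro w
      rw [hstart 0 rfl]
      exact hjump _ w)
  refine ⟨P, T0, hA, hB, ?_⟩
  intro q hq
  obtain ⟨T, h1, h2, h3⟩ := hC q hq
  obtain ⟨T', s, g1, g2, g3⟩ := hnear T
  have hY : T ≤ T' + Y := by
    have := hinv T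
    have := hxY (F T).1
    omega
  have hdiff : ∀ d (i : Fin n), posOf (C T') i ≤ posOf (C (T' + d)) i ∧
      posOf (C (T' + d)) i ≤ posOf (C T') i + d := by
    intro d i
    induction d with
    | zero => simp
    | succ d ih =>
      have := hinc (T' + d) i
      rw [← add_assoc]
      omega
  refine ⟨s, ?_, ?_⟩
  · rw [← g3, hsum T']
    have e1 : δ * ((T0 + T : ℕ) : ℝ) ≤ δ * ((T0 + T' : ℕ) : ℝ) + δ * Y := by
      rw [← mul_add]
      apply mul_le_mul_of_nonneg_left _ hδ.le
      have : T0 + T ≤ T0 + T' + Y := by omega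
      exact_mod_cast this
    have e2 : δ * ((T0 + T' : ℕ) : ℝ) ≤ δ * ((T0 + T : ℕ) : ℝ) := by
      apply mul_le_mul_of_nonneg_left _ hδ.le
      have : T0 + T' ≤ T0 + T := by omega
      exact_mod_cast this
    have e3 : δ * ((T0 + T + 1 : ℕ) : ℝ) = δ * ((T0 + T : ℕ) : ℝ) + δ := by push_cast; ring
    have e4 : 0 ≤ δ * (Y : ℝ) := by positivity
    rw [abs_le]
    constructor <;> nlinarith
  · intro i
    have hd := hdiff (T - T') i
    rw [Nat.add_sub_cancel' g1, g3] at hd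
    have h3i := h3 i
    have e1 : δ * (posOf (c s) i : ℝ) ≤ δ * (posOf (C T) i : ℝ) := by
      apply mul_le_mul_of_nonneg_left _ hδ.le
      exact_mod_cast hd.1
    have e2 : δ * (posOf (C T) i : ℝ) ≤ δ * (posOf (c s) i : ℝ) + δ * Y := by
      rw [← mul_add]
      apply mul_le_mul_of_nonneg_left _ hδ.le
      have : posOf (C T) i ≤ posOf (c s) i + Y := by omega
      exact_mod_cast this
    have e4 : 0 ≤ δ * (Y : ℝ) := by positivity
    rw [abs_le]
    constructor <;> nlinarith

/-- Spreading a coarse counting function over `n` unit steps. -/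
def spread (n : ℕ) (k : ℕ → ℕ) (z : ℕ) : ℕ := min (k (z / n) + z % n) (k (z / n + 1))

theorem spread_eq (n : ℕ) (k : ℕ → ℕ) (a r : ℕ) (hr : r < n) :
    spread n k (n * a + r) = min (k a + r) (k (a + 1)) := by
  unfold spread
  rw [Nat.mul_add_div (by omega), Nat.div_eq_of_lt hr, Nat.mul_add_mod, Nat.mod_eq_of_lt hr]
  simp

theorem le_spread (n : ℕ) (k : ℕ → ℕ) (hk : Monotone k) (z : ℕ) : k (z / n) ≤ spread n k z :=
  le_min (Nat.le_add_right _ _) (hk (Nat.le_succ _))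

theorem exists_decomp (n : ℕ) (hn : 0 < n) (z : ℕ) : ∃ a r, r < n ∧ z = n * a + r :=
  ⟨z / n, z % n, Nat.mod_lt _ hn, (Nat.div_add_mod z n).symm⟩

theorem rigid_of_coarse (n : ℕ) (hn2 : 2 ≤ n) (δ : ℝ) (hδ : 0 < δ) (κ : ℕ → ℕ → ℕ) (ls : ℕ → ℕ)
    (hmono : ∀ s, Monotone (κ s)) (hn : ∀ s w, κ s w ≤ n) (hev : ∀ s, ∃ w, κ s w = n)
    (hzero : ∀ s, κ s 0 = 0)
    (hdec : ∀ s, κ s (ls s) = κ (s + 1) (ls s) + 1)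
    (hoth : ∀ s w, w ≠ ls s → κ s w = κ (s + 1) w)
    (hls : ∀ s, ls (s + 1) ≤ ls s + 1) :
    ∃ (P : ℝ → Fin n → ℝ) (T0 : ℕ), IsNSystem n (Ici (δ * T0)) P ∧ IsRigid n δ (δ * T0) P ∧
      ∀ q ≥ δ * T0, ∃ s, ∃ p : Fin n → ℕ, |q - δ * ((∑ i : Fin n, p i : ℕ) : ℝ)| ≤ δ * (3 * n + 1) ∧
        (∀ i, |P q i - δ * p i| ≤ δ * (3 * n + 1)) ∧
        (∀ i : Fin n, (i : ℕ) < κ s (p i / n + 1)) ∧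
        (∀ i : Fin n, κ s ((p i - 1) / n) ≤ (i : ℕ)) := by
  have hn0 : 0 < n := by omega
  have hl1 : ∀ s, 1 ≤ ls s := by
    intro s
    by_contra h
    have h0 : ls s = 0 := by omega
    have h1 := hdec s
    rw [h0, hzero] at h1
    omega
  have hcmono : ∀ s, Monotone (spread n (κ s)) := by
    intro s
    apply monotone_nat_of_le_succ
    intro z
    obtain ⟨a, r, hr, rfl⟩ := exists_decomp n hn0 z
    rw [spread_eq _ _ _ _ hr]
    by_cases h : r + 1 < n
    · rw [add_assoc, spread_eq _ _ _ _ h]; omega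
    · have e : n * a + r + 1 = n * (a + 1) + 0 := by rw [mul_add]; omega
      rw [e, spread_eq _ _ _ _ hn0]
      have := hmono s (Nat.le_succ (a + 1))
      simp only [Nat.succ_eq_add_one] at this
      omega
  have hcev : ∀ s, ∃ w, spread n (κ s) w = n := by
    intro s
    obtain ⟨w, hw⟩ := hev s
    refine ⟨n * w + 0, ?_⟩
    rw [spread_eq _ _ _ _ hn0]
    have := hmono s (Nat.le_succ w)
    have := hn s (w + 1)
    simp only [Nat.succ_eq_add_one] at *
    omega
  have hcn : ∀ s w, spread n (κ s) w ≤ n := by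
    intro s w
    unfold spread
    have := hn s (w / n + 1)
    omega
  have key : ∀ s, κ s (ls s - 1) ≤ κ (s + 1) (ls s) ∧ κ s (ls s) ≤ κ s (ls s + 1) := by
    intro s
    refine ⟨?_, hmono s (Nat.le_succ _)⟩
    have h1 := hl1 s
    rw [hoth s (ls s - 1) (by omega)]
    exact hmono _ (by omega)
  have hcase : ∀ s a r, r < n →
      ((n * (ls s - 1) + (κ s (ls s) - κ s (ls s - 1)) ≤ n * a + r ∧
        n * a + r < n * ls s + (κ s (ls s + 1) - κ s (ls s)) + 1) →
        spread n (κ s) (n * a + r) = spread n (κ (s+1)) (n * a + r) + 1) ∧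
      (¬ (n * (ls s - 1) + (κ s (ls s) - κ s (ls s - 1)) ≤ n * a + r ∧
        n * a + r < n * ls s + (κ s (ls s + 1) - κ s (ls s)) + 1) →
        spread n (κ s) (n * a + r) = spread n (κ (s+1)) (n * a + r)) := by
    intro s a r hr
    rw [spread_eq _ _ _ _ hr, spread_eq _ _ _ _ hr]
    have h1 := hl1 s
    have h2 := key s
    have h3 := hdec s
    have h4 := hn s (ls s)
    have h5 := hn s (ls s + 1)
    obtain ⟨l, hl⟩ : ∃ l, ls s = l + 1 := ⟨ls s - 1, by omega⟩
    have hoth' := hoth s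
    rw [hl] at h1 h2 h3 h4 h5 hoth'
    rw [hl]
    simp only [Nat.add_sub_cancel] at h1 h2 h3 h4 h5 hoth' ⊢
    have h6 := hoth' l (by omega)
    rcases Nat.lt_trichotomy a l with h | h | h
    · rw [← hoth' a (by omega), ← hoth' (a + 1) (by omega)]
      have : n * (a + 1) ≤ n * l := Nat.mul_le_mul_left _ h
      rw [mul_add] at this
      constructor <;> intro g <;> omega
    · subst h
      rw [← hoth' a (by omega)]
      rw [mul_add]
      constructor <;> intro g <;> omega
    · rcases Nat.lt_or_ge a (l + 2) with h' | h'
      · obtain rfl : a = l + 1 := by omega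
        rw [← hoth' (l + 1 + 1) (by omega)]
        rw [mul_add]
        constructor <;> intro g <;> omega
      · rw [← hoth' a (by omega), ← hoth' (a + 1) (by omega)]
        have : n * (l + 2) ≤ n * a := Nat.mul_le_mul_left _ h'
        rw [mul_add] at this
        constructor <;> intro g
        · rw [mul_add] at g; omega
        · rfl
  obtain ⟨P, T0, hA, hB, hC⟩ := rigid_of_jumps n δ hδ (fun s => spread n (κ s))
    (fun s => n * (ls s - 1) + (κ s (ls s) - κ s (ls s - 1)))
    (fun s => n * ls s + (κ s (ls s + 1) - κ s (ls s)) + 1) (3 * n)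
    hcmono hcn hcev
    (by
      intro s
      have := spread_eq n (κ s) 0 0 hn0
      rw [hzero] at this
      simp only [mul_zero, add_zero, Nat.zero_min] at this
      exact this)
    (by
      intro s
      obtain ⟨l, hl⟩ : ∃ l, ls s = l + 1 := ⟨ls s - 1, by have := hl1 s; omega⟩
      rw [hl]
      simp only [Nat.add_sub_cancel, mul_add]
      have := hn s (l + 1)
      omega)
    (by
      intro s
      obtain ⟨l, hl⟩ : ∃ l, ls s = l + 1 := ⟨ls s - 1, by have := hl1 s; omega⟩
      rw [hl]
      simp only [Nat.add_sub_cancel, mul_add]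
      have := hn s (l + 1)
      have := hn s (l + 1 + 1)
      omega)
    (by
      intro s w h1 h2
      obtain ⟨a, r, hr, rfl⟩ := exists_decomp n hn0 w
      exact (hcase s a r hr).1 ⟨h1, h2⟩)
    (by
      intro s w h1
      obtain ⟨a, r, hr, rfl⟩ := exists_decomp n hn0 w
      exact (hcase s a r hr).2 (by omega))
    (by
      intro s w h1
      obtain ⟨a, r, hr, rfl⟩ := exists_decomp n hn0 w
      exact (hcase s a r hr).2 (by omega))
    (by
      intro s
      have h1 := hls s
      rcases Nat.lt_or_ge (ls (s+1)) (ls s + 1) with h | h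
      · have h2 := hl1 (s + 1)
        have : n * (ls (s+1) - 1 + 1) ≤ n * ls s := Nat.mul_le_mul_left _ (by omega)
        rw [mul_add] at this
        have := hn (s+1) (ls (s+1))
        omega
      · have e : ls (s+1) = ls s + 1 := by omega
        rw [e, Nat.add_sub_cancel, hoth s (ls s + 1) (by omega)]
        have := hdec s
        have := (key s).2
        omega)
    (by
      intro s w
      obtain ⟨a, r, hr, rfl⟩ := exists_decomp n hn0 w
      rw [spread_eq _ _ _ _ hr]
      by_cases h : r + 1 < n
      · rw [add_assoc, spread_eq _ _ _ _ h]; omega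
      · have e : n * a + r + 1 = n * (a + 1) + 0 := by rw [mul_add]; omega
        rw [e, spread_eq _ _ _ _ hn0]
        have := hn s (a + 1)
        omega)
  refine ⟨P, T0, hA, hB, ?_⟩
  intro q hq
  obtain ⟨s, h1, h2⟩ := hC q hq
  refine ⟨s, fun i => posOf (spread n (κ s)) i, ?_, ?_, ?_, ?_⟩
  · push_cast at h1 ⊢; exact h1
  · push_cast at h2 ⊢; exact h2
  · intro i
    have hex : ∃ z, (i : ℕ) < spread n (κ s) z := by
      obtain ⟨w, hw⟩ := hcev s
      exact ⟨w, by rw [hw]; exact i.2⟩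
    have := (lt_posOf_iff (hcmono s) hex (posOf (spread n (κ s)) i)).not.1 (lt_irrefl _)
    dsimp only
    unfold spread at this ⊢
    omega
  · intro i
    have hex : ∃ z, (i : ℕ) < spread n (κ s) z := by
      obtain ⟨w, hw⟩ := hcev s
      exact ⟨w, by rw [hw]; exact i.2⟩
    dsimp only
    rcases Nat.eq_zero_or_pos (posOf (spread n (κ s)) i) with h0 | h0
    · rw [h0]; simp [hzero]
    · have := (lt_posOf_iff (hcmono s) hex (posOf (spread n (κ s)) i - 1)).1 (by omega)
      have h3 : κ s ((posOf (spread n (κ s)) i - 1) / n) ≤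
        spread n (κ s) (posOf (spread n (κ s)) i - 1) := by
        exact le_spread n _ (hmono s) _
      omega

/-- `log max(1, t e^q)`. -/
def lam (t q : ℝ) : ℝ := Real.log (max 1 (t * Real.exp q))

theorem lam_nonneg (t q : ℝ) : 0 ≤ lam t q := Real.log_nonneg (le_max_left _ _)

theorem lam_mono {t t' q q' : ℝ} (h0 : 0 ≤ t) (h : t ≤ t') (hq : q ≤ q') : lam t q ≤ lam t' q' := by
  unfold lam
  apply Real.log_le_log (by positivity)
  apply max_le_max le_rfl
  have := Real.exp_le_exp.2 hq
  have := Real.exp_pos q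
  nlinarith

theorem lam_zero {t q : ℝ} (h : t * Real.exp q ≤ 1) : lam t q = 0 := by
  unfold lam
  rw [max_eq_left h, Real.log_one]

theorem lam_add {t q q' : ℝ} (h : 1 ≤ t * Real.exp q) (hq : q ≤ q') :
    lam t q' = lam t q + (q' - q) := by
  have ht : 0 < t := by
    by_contra h'
    have := Real.exp_pos q
    nlinarith
  have h' : 1 ≤ t * Real.exp q' := h.trans (by gcongr)
  unfold lam
  rw [max_eq_right h, max_eq_right h', Real.log_mul ht.ne' (Real.exp_pos _).ne',
    Real.log_mul ht.ne' (Real.exp_pos _).ne', Real.log_exp, Real.log_exp]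
  ring

theorem lam_le {t q q' : ℝ} (hq : q ≤ q') :
    lam t q' ≤ lam t q + (q' - q) := by
  unfold lam
  rw [← Real.log_exp (q' - q), ← Real.log_mul (by positivity) (by positivity)]
  apply Real.log_le_log (by positivity)
  have h1 : (1 : ℝ) ≤ Real.exp (q' - q) := Real.one_le_exp (by linarith)
  have e : t * Real.exp q' = t * Real.exp q * Real.exp (q' - q) := by
    rw [mul_assoc, ← Real.exp_add]; ring_nf
  rw [e]
  apply max_le
  · calc (1:ℝ) ≤ 1 * Real.exp (q' - q) := by linarith
      _ ≤ _ := by gcongr; exact le_max_left _ _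
  · gcongr; exact le_max_right _ _

theorem lam_sub {t t' q q' : ℝ} (h0 : 0 ≤ t) (h : t ≤ t') (hq : q ≤ q') :
    lam t q' - lam t q ≤ lam t' q' - lam t' q := by
  rcases le_total 1 (t' * Real.exp q) with h1 | h1
  · rw [lam_add h1 hq]
    have := lam_le (t := t) hq
    linarith
  · have h2 : t * Real.exp q ≤ 1 := le_trans (by gcongr) h1
    rw [lam_zero h1, lam_zero h2]
    have := lam_mono h0 h (le_refl q')
    linarith

theorem lam_continuous (t : ℝ) : Continuous (lam t) := by
  unfold lam
  apply Continuous.log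
  · fun_prop
  · intro q; positivity

/-- Abstract data extracted from the geometry of numbers. -/
structure FD (n : ℕ) (S : Type) [PartialOrder S] where
  dim : S → ℕ
  a : S → ℝ
  σ : S → ℝ
  L : ℝ → ℕ → ℝ
  F : ℝ → ℕ → S
  C : ℝ
  qs : ℝ
  hC : 0 ≤ C
  dimF : ∀ q k, k ≤ n → dim (F q k) = k
  Fmono : ∀ q, Monotone (F q)
  dimle : ∀ V, dim V ≤ n
  h2 : ∀ V q, (∑ j ∈ Finset.range (dim V), L q j) - C ≤ a V + lam (σ V) q
  h3 : ∀ V q, V ≠ F q (dim V) → 0 < dim V ∧ dim V < n ∧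
    (∑ j ∈ Finset.range (dim V), L q j) + (L q (dim V) - L q (dim V - 1)) - C ≤ a V + lam (σ V) q
  h4 : ∀ q k, k ≤ n → a (F q k) + lam (σ (F q k)) q ≤ (∑ j ∈ Finset.range k, L q j) + C
  L0 : ∀ q j, 0 ≤ L q j
  Lmono : ∀ q, Monotone (L q)
  Lle : ∀ q q' j, q ≤ q' → L q j ≤ L q' j
  Llip : ∀ q q' j, q ≤ q' → L q' j ≤ L q j + (q' - q)
  Lsum : ∀ q, qs ≤ q → |(∑ j ∈ Finset.range n, L q j) - q| ≤ C
  σ0 : ∀ V, 0 ≤ σ V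
  σmono : Monotone σ
  fin : ∀ R, {V | a V ≤ R}.Finite
  σtop : ∀ V, dim V = n → 1 ≤ σ V * Real.exp qs

namespace FD
variable {n : ℕ} {S : Type} [PartialOrder S] (X : FD n S) (h : ℝ)

def B : ℝ := 2 * X.C + (4 * X.C + 1) * n
def xl (l : ℕ) : ℝ := h * l - (X.B + 1)
def pen (k : ℕ) : ℝ := (4 * X.C + 1) * (k * (n - k))
def Phi (V : S) (q : ℝ) : ℝ := X.a V + lam (X.σ V) q
def M (q : ℝ) (k : ℕ) : ℝ := ∑ j ∈ Finset.range k, X.L q j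
def f (l : ℕ) (q : ℝ) (V : S) : ℝ := X.Phi V q + X.pen (X.dim V) - X.xl h l * X.dim V
def Mini (l : ℕ) (q : ℝ) (V : S) : Prop := ∀ V', X.f h l q V ≤ X.f h l q V'

theorem M_succ (q : ℝ) (k : ℕ) : X.M q (k + 1) = X.M q k + X.L q k := Finset.sum_range_succ _ _

theorem f_F (l : ℕ) (q : ℝ) (k : ℕ) (hk : k ≤ n) :
    X.f h l q (X.F q k) ≤ X.M q k + X.C + X.pen k - X.xl h l * k := by
  unfold f
  rw [X.dimF q k hk]
  have := X.h4 q k hk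
  unfold Phi M
  linarith

theorem mini_flag {l : ℕ} {q : ℝ} {V : S} (hV : X.Mini h l q V) : V = X.F q (X.dim V) := by
  by_contra hne
  obtain ⟨h0, h1, h2⟩ := X.h3 V q hne
  obtain ⟨k, hk⟩ : ∃ k, X.dim V = k + 1 := ⟨X.dim V - 1, by omega⟩
  have a1 := (hV (X.F q k)).trans (X.f_F h l q k (by omega))
  have a2 := (hV (X.F q (k + 2))).trans (X.f_F h l q (k + 2) (by omega))
  have e1 : X.f h l q V = X.Phi V q + X.pen (k + 1) - X.xl h l * ((k + 1 : ℕ) : ℝ) := by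
    unfold f; rw [hk]
  rw [e1] at a1 a2
  rw [X.M_succ, X.M_succ] at a2
  rw [hk] at h2
  change X.M q (k + 1) + _ - _ ≤ X.Phi V q at h2
  rw [X.M_succ, Nat.add_sub_cancel] at h2
  have hg := X.Lmono q (Nat.le_succ k)
  unfold pen at a1 a2
  push_cast at a1 a2 hg
  have := X.hC
  nlinarith

theorem mini_lower {l : ℕ} {q : ℝ} {V : S} (hV : X.Mini h l q V) {j : ℕ} (hj : j < X.dim V) :
    X.L q j ≤ X.xl h l + X.B := by
  obtain ⟨k, hk⟩ : ∃ k, X.dim V = k + 1 := ⟨X.dim V - 1, by omega⟩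
  have hn := X.dimle V
  have a1 := (hV (X.F q k)).trans (X.f_F h l q k (by omega))
  have e1 : X.f h l q V = X.Phi V q + X.pen (k + 1) - X.xl h l * ((k + 1 : ℕ) : ℝ) := by
    unfold f; rw [hk]
  have h2 := X.h2 V q
  change X.M q _ - _ ≤ X.Phi V q at h2
  rw [e1] at a1
  rw [hk, X.M_succ] at h2
  have hg := X.Lmono q (show j ≤ k by omega)
  unfold pen at a1
  unfold B
  push_cast at a1
  have := X.hC
  have hkn : (k : ℝ) + 1 ≤ n := by rw [hk] at hn; exact_mod_cast hn
  nlinarith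

theorem mini_upper {l : ℕ} {q : ℝ} {V : S} (hV : X.Mini h l q V) {j : ℕ} (hj : X.dim V ≤ j)
    (hjn : j < n) : X.xl h l - X.B ≤ X.L q j := by
  obtain ⟨k, hk⟩ : ∃ k, X.dim V = k := ⟨X.dim V, rfl⟩
  have a1 := (hV (X.F q (k + 1))).trans (X.f_F h l q (k + 1) (by omega))
  have e1 : X.f h l q V = X.Phi V q + X.pen k - X.xl h l * (k : ℝ) := by
    unfold f; rw [hk]
  have h2 := X.h2 V q
  change X.M q _ - _ ≤ X.Phi V q at h2
  rw [e1, X.M_succ] at a1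
  rw [hk] at h2
  have hg := X.Lmono q (show k ≤ j by omega)
  unfold pen at a1
  unfold B
  push_cast at a1
  have := X.hC
  have hkn : (0 : ℝ) ≤ k := by positivity
  nlinarith

theorem mini_le {q : ℝ} {l l' : ℕ} {V V' : S} (hV : X.Mini h l q V) (hV' : X.Mini h l' q V')
    (hd : X.dim V ≤ X.dim V') : V ≤ V' := by
  rw [X.mini_flag h hV, X.mini_flag h hV']
  exact X.Fmono q hd

theorem mini_dim {h : ℝ} (hh : 0 < h) {q : ℝ} {l l' : ℕ} {V V' : S} (hV : X.Mini h l q V)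
    (hV' : X.Mini h l' q V') (hl : l < l') : X.dim V ≤ X.dim V' := by
  by_contra hc
  have h1 := hV V'
  have h2 := hV' V
  unfold f xl at h1 h2
  have h3 : (l : ℝ) + 1 ≤ l' := by exact_mod_cast hl
  have h4 : (X.dim V' : ℝ) + 1 ≤ X.dim V := by exact_mod_cast (not_le.1 hc)
  have h5 : 0 < h * ((l' - l) * (X.dim V - X.dim V') : ℝ) := by
    apply mul_pos hh (mul_pos _ _) <;> linarith
  nlinarith

theorem f_lower (l : ℕ) (q : ℝ) (V : S) : X.a V - |X.xl h l| * n ≤ X.f h l q V := by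
  unfold f Phi pen
  have h1 := lam_nonneg (X.σ V) q
  have h2 : (X.dim V : ℝ) ≤ n := by exact_mod_cast X.dimle V
  have h3 : (0 : ℝ) ≤ X.dim V := by positivity
  have h4 : X.xl h l * X.dim V ≤ |X.xl h l| * n :=
    (mul_le_mul_of_nonneg_right (le_abs_self _) h3).trans
      (mul_le_mul_of_nonneg_left h2 (abs_nonneg _))
  have h5 : 0 ≤ (4 * X.C + 1) * ((X.dim V : ℝ) * (n - X.dim V)) := by
    have := X.hC
    apply mul_nonneg (by linarith) (mul_nonneg h3 (by linarith))
  linarith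

theorem exists_mini (l : ℕ) (q : ℝ) : ∃ V, X.Mini h l q V := by
  let V0 := X.F q 0
  have hfin : {V | X.f h l q V ≤ X.f h l q V0}.Finite := by
    apply (X.fin (X.f h l q V0 + |X.xl h l| * n)).subset
    intro V hV
    have := X.f_lower h l q V
    change X.f h l q V ≤ X.f h l q V0 at hV
    change X.a V ≤ X.f h l q V0 + |X.xl h l| * n
    linarith
  obtain ⟨V, hV, hm⟩ := hfin.exists_minimalFor (X.f h l q) _ ⟨V0, le_refl (X.f h l q V0)⟩
  refine ⟨V, fun V' => ?_⟩
  by_contra hc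
  push Not at hc
  have hV' : V' ∈ {V | X.f h l q V ≤ X.f h l q V0} := hc.le.trans hV
  exact absurd (hm hV' hc.le) (not_le.2 hc)

theorem f_cont (l : ℕ) (V : S) : Continuous (fun q => X.f h l q V) := by
  unfold f Phi
  have := lam_continuous (X.σ V)
  fun_prop

theorem mini_top {l : ℕ} {q : ℝ} {V : S} (hV : X.Mini h l q V)
    (hl : X.L q (n - 1) + X.B < X.xl h l) : X.dim V = n := by
  have := X.dimle V
  by_contra hne
  have := X.mini_upper h hV (j := n - 1) (by omega) (by omega)
  linarith

theorem exists_large {h : ℝ} (hh : 0 < h) (R : ℝ) : ∃ J, ∀ l ≥ J, R < X.xl h l := by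
  obtain ⟨J, hJ⟩ := exists_nat_gt ((R + (X.B + 1)) / h)
  refine ⟨J, fun l hl => ?_⟩
  rw [div_lt_iff₀ hh] at hJ
  have : (J : ℝ) ≤ l := by exact_mod_cast hl
  unfold xl
  nlinarith

theorem top_unique {V : S} (q : ℝ) (hV : X.dim V = n) : V = X.F q n := by
  by_contra hne
  have := X.h3 V q (fun e => hne (e.trans (by rw [hV])))
  omega

end FD

namespace FD
variable {n : ℕ} {S : Type} [PartialOrder S] (X : FD n S) {h : ℝ}

theorem event (hh : 0 < h) (hn : 0 < n) {q : ℝ} (hq : X.qs ≤ q) {U : ℕ → S} {l : ℕ}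
    (hU : ∀ j, X.Mini h j q (U j)) (hmem : 1 ≤ X.σ (U (l + 1)) * Real.exp q) :
    ∃ (q' : ℝ) (l' : ℕ) (V : S), q ≤ q' ∧ (∀ j, X.Mini h j q' (U j)) ∧ X.Mini h l' q' V ∧
      X.dim V < X.dim (U l') ∧ l' ≤ l + 1 ∧ 1 ≤ X.σ (U (l' + 1)) * Real.exp q' := by
  set A : Set ℝ := {p | q ≤ p ∧ ∀ j, X.Mini h j p (U j)} with hA
  have hqA : q ∈ A := ⟨le_rfl, hU⟩
  have hcl : IsClosed A := by
    have : A = Ici q ∩ ⋂ j, ⋂ V', {p | X.f h j p (U j) ≤ X.f h j p V'} := by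
      ext p
      simp only [mem_inter_iff, mem_iInter, mem_Ici]
      rfl
    rw [this]
    apply isClosed_Ici.inter
    apply isClosed_iInter; intro j
    apply isClosed_iInter; intro V'
    exact isClosed_le (X.f_cont h j _) (X.f_cont h j _)
  have hbd : BddAbove A := by
    obtain ⟨J, hJ⟩ := X.exists_large hh (X.L q (n - 1) + X.B)
    have hJ' := X.mini_top h (hU J) (hJ J le_rfl)
    refine ⟨n * (X.xl h J + X.B) + X.C, ?_⟩
    rintro p ⟨hp, hpU⟩
    have h1 : ∀ j ∈ Finset.range n, X.L p j ≤ X.xl h J + X.B := by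
      intro j hj
      apply X.mini_lower h (hpU J)
      rw [hJ']; exact Finset.mem_range.1 hj
    have h2 := Finset.sum_le_sum h1
    rw [Finset.sum_const, Finset.card_range, nsmul_eq_mul] at h2
    have h3 := X.Lsum p (hq.trans hp)
    rw [abs_le] at h3
    linarith
  set q' := sSup A with hq'
  have hq'A : q' ∈ A := hcl.csSup_mem ⟨q, hqA⟩ hbd
  have hqq' : q ≤ q' := hq'A.1
  have hU' := hq'A.2
  -- the next change
  obtain ⟨J, hJ⟩ := X.exists_large hh (X.L (q' + 1) (n - 1) + X.B)
  have hJtop : ∀ p, p ≤ q' + 1 → ∀ j ≥ J, ∀ V, X.Mini h j p V → X.dim V = n := by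
    intro p hp j hj V hV
    apply X.mini_top h hV
    have := X.Lle p (q' + 1) (n - 1) hp
    have := hJ j hj
    linarith
  set cand : Set (ℕ × S) := ⋃ j ∈ Iio J, (fun V => (j, V)) ''
    {V | X.a V ≤ X.Phi (U j) (q' + 1) + X.pen (X.dim (U j)) - X.xl h j * X.dim (U j)
      + |X.xl h j| * n} with hcand
  have hcfin : cand.Finite := by
    apply (Set.finite_Iio J).biUnion
    intro j _
    exact (X.fin _).image _
  have hfreq : ∃ jV : ℕ × S, ∃ᶠ p in nhdsWithin q' (Ioi q'),
      X.f h jV.1 p jV.2 < X.f h jV.1 p (U jV.1) := by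
    by_contra hc
    push Not at hc
    have h1 : ∀ᶠ p in nhdsWithin q' (Ioi q'), ∀ jV ∈ cand,
        ¬ X.f h jV.1 p jV.2 < X.f h jV.1 p (U jV.1) := by
      rw [Filter.eventually_all_finite hcfin]
      intro jV _
      have := hc jV
      simpa [Filter.not_frequently] using this
    have h2 : ∀ᶠ p in nhdsWithin q' (Ioi q'), p ∈ Ioc q' (q' + 1) :=
      Ioc_mem_nhdsGT (by linarith)
    obtain ⟨p, hp1, hp2⟩ := (h1.and h2).exists
    have hpA : p ∉ A := fun hpA => absurd (le_csSup hbd hpA) (not_le.2 hp2.1)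
    have hpA' : ¬ ∀ j, X.Mini h j p (U j) := fun hall => hpA ⟨hqq'.trans hp2.1.le, hall⟩
    push Not at hpA'
    obtain ⟨j, hj⟩ := hpA'
    obtain ⟨V, hV⟩ := X.exists_mini h j p
    have hlt : X.f h j p V < X.f h j p (U j) := by
      by_contra hge
      exact hj (fun V' => (not_lt.1 hge).trans (hV V'))
    have hjJ : j < J := by
      by_contra hjJ
      have e1 := X.top_unique p (hJtop p hp2.2 j (not_lt.1 hjJ) V hV)
      have e2 := X.top_unique p (hJtop q' (by linarith) j (not_lt.1 hjJ) (U j) (hU' j))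
      rw [e1, e2] at hlt
      exact lt_irrefl _ hlt
    refine hp1 (j, V) ?_ hlt
    rw [hcand]
    simp only [mem_iUnion]
    refine ⟨j, hjJ, V, ?_, rfl⟩
    change X.a V ≤ X.Phi (U j) (q' + 1) + X.pen (X.dim (U j)) - X.xl h j * X.dim (U j)
      + |X.xl h j| * n
    have h3 := X.f_lower h j p V
    have h4 : X.Phi (U j) p ≤ X.Phi (U j) (q' + 1) := by
      unfold Phi
      have := lam_mono (X.σ0 (U j)) le_rfl hp2.2
      linarith
    unfold f at h3 hlt
    linarith
  obtain ⟨⟨l', V⟩, hf⟩ := hfreq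
  dsimp only at hf
  have hVle : X.f h l' q' V ≤ X.f h l' q' (U l') := by
    by_contra hc
    push Not at hc
    have h1 : ∀ᶠ p in nhds q', X.f h l' p (U l') < X.f h l' p V :=
      (X.f_cont h l' (U l')).continuousAt.eventually_lt (X.f_cont h l' V).continuousAt hc
    obtain ⟨p, hp1, hp2⟩ := (hf.and_eventually (h1.filter_mono nhdsWithin_le_nhds)).exists
    linarith
  have hVmin : X.Mini h l' q' V := fun V' => hVle.trans (hU' l' V')
  have hgap : ∃ p, q' < p ∧ lam (X.σ V) p - lam (X.σ V) q' <
      lam (X.σ (U l')) p - lam (X.σ (U l')) q' := by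
    obtain ⟨p, hp1, hp2⟩ := (hf.and_eventually (self_mem_nhdsWithin (s := Ioi q'))).exists
    refine ⟨p, hp2, ?_⟩
    have := hU' l' V
    unfold f Phi at hp1 this
    linarith
  obtain ⟨p, hp, hgap⟩ := hgap
  have hdim : X.dim V < X.dim (U l') := by
    by_contra hc
    have := X.mini_le h (hU' l') hVmin (not_lt.1 hc)
    have := lam_sub (X.σ0 _) (X.σmono this) hp.le
    linarith
  have hσV : X.σ V * Real.exp q' < 1 := by
    by_contra hc
    have h1 := lam_add (not_lt.1 hc) hp.le
    have h2 := lam_le (t := X.σ (U l')) hp.le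
    linarith
  have hσU : 1 ≤ X.σ (U l') * Real.exp q' := by
    by_contra hc
    push Not at hc
    have h1 : ∀ᶠ p in nhds q', X.σ (U l') * Real.exp p < 1 :=
      (by fun_prop : Continuous fun p => X.σ (U l') * Real.exp p).continuousAt.eventually_lt
        continuousAt_const hc
    obtain ⟨p, ⟨hp1, hp2⟩, hp3⟩ := ((hf.and_eventually (h1.filter_mono nhdsWithin_le_nhds)).and_eventually
      (self_mem_nhdsWithin (s := Ioi q'))).exists
    have h2 := lam_zero hc.le
    have h3 := lam_zero hp2.le
    have h4 := lam_mono (X.σ0 V) le_rfl (le_of_lt hp3)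
    have := hU' l' V
    unfold f Phi at hp1 this
    linarith
  refine ⟨q', l', V, hqq', hU', hVmin, hdim, ?_, ?_⟩
  · by_contra hc
    push Not at hc
    have h1 := X.mini_le h (hU' (l + 1)) hVmin (X.mini_dim hh (hU' (l + 1)) hVmin hc)
    have h2 := X.σmono h1
    have h3 : X.σ (U (l + 1)) * Real.exp q ≤ X.σ V * Real.exp q' :=
      mul_le_mul h2 (Real.exp_le_exp.2 hqq') (Real.exp_pos _).le (X.σ0 _)
    linarith
  · have h1 := X.mini_le h (hU' l') (hU' (l' + 1))
      (X.mini_dim hh (hU' l') (hU' (l' + 1)) (Nat.lt_succ_self _))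
    exact hσU.trans (mul_le_mul_of_nonneg_right (X.σmono h1) (Real.exp_pos _).le)

/-- State of the construction. -/
structure St (X : FD n S) (h : ℝ) where
  q : ℝ
  U : ℕ → S
  l : ℕ
  k : ℕ
  hq : X.qs ≤ q
  hU : ∀ j, X.Mini h j q (U j)
  hmem : 1 ≤ X.σ (U (l + 1)) * Real.exp q
  hW : ∃ W, X.Mini h l q W ∧ k ≤ X.dim W
  hk : X.dim (U l) < k

def St.kap {X : FD n S} (s : X.St h) (j : ℕ) : ℕ := if j = s.l then s.k else X.dim (s.U j)

theorem St.mono (hh : 0 < h) (s : X.St h) : Monotone s.kap := by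
  apply monotone_nat_of_le_succ
  intro j
  obtain ⟨W, hW1, hW2⟩ := s.hW
  have hk := s.hk
  unfold St.kap
  have h0 := X.mini_dim hh (s.hU j) (s.hU (j + 1)) (Nat.lt_succ_self _)
  by_cases h1 : j = s.l
  · subst h1
    have := X.mini_dim hh hW1 (s.hU (s.l + 1)) (Nat.lt_succ_self _)
    simp
    omega
  · by_cases h2 : j + 1 = s.l
    · rw [if_neg h1, if_pos h2]
      rw [h2] at h0
      omega
    · rw [if_neg h1, if_neg h2]
      exact h0

theorem St.le (s : X.St h) (j : ℕ) : s.kap j ≤ n := by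
  obtain ⟨W, hW1, hW2⟩ := s.hW
  unfold St.kap
  split_ifs
  · exact hW2.trans (X.dimle W)
  · exact X.dimle _

theorem St.lower (s : X.St h) (l j : ℕ) (hj : j < s.kap l) : X.L s.q j ≤ X.xl h l + X.B := by
  obtain ⟨W, hW1, hW2⟩ := s.hW
  unfold St.kap at hj
  split_ifs at hj with h1
  · rw [h1]; exact X.mini_lower h hW1 (by omega)
  · exact X.mini_lower h (s.hU l) hj

theorem St.upper (s : X.St h) (l j : ℕ) (hj : s.kap l ≤ j) (hjn : j < n) :
    X.xl h l - X.B ≤ X.L s.q j := by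
  unfold St.kap at hj
  apply X.mini_upper h (s.hU l) _ hjn
  have := s.hk
  split_ifs at hj with h1
  · rw [h1]; omega
  · exact hj

theorem St.zero (s : X.St h) : s.kap 0 = 0 := by
  by_contra hc
  have h1 := s.lower X 0 0 (by omega)
  have h2 := X.L0 s.q 0
  unfold xl at h1
  push_cast at h1
  linarith

theorem St.ev (hh : 0 < h) (s : X.St h) (hn : 0 < n) : ∃ w, s.kap w = n := by
  obtain ⟨J, hJ⟩ := X.exists_large hh (X.L s.q (n - 1) + X.B)
  refine ⟨J, ?_⟩
  by_contra hc
  have := s.le X J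
  have := s.upper X J (n - 1) (by omega) (by omega)
  have := hJ J le_rfl
  linarith

theorem St.ofEvent (hh : 0 < h) (hn : 0 < n) {q : ℝ} (hq : X.qs ≤ q) {U : ℕ → S} {l : ℕ}
    (hU : ∀ j, X.Mini h j q (U j)) (hmem : 1 ≤ X.σ (U (l + 1)) * Real.exp q) :
    ∃ s : X.St h, s.l ≤ l + 1 ∧ ∀ j, s.kap j = X.dim (U j) := by
  obtain ⟨q', l', V, h1, h2, h3, h4, h5, h6⟩ := X.event hh hn hq hU hmem
  refine ⟨⟨q', Function.update U l' V, l', X.dim (U l'), hq.trans h1, ?_, ?_, ?_, ?_⟩, h5, ?_⟩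
  · intro j
    by_cases hj : j = l'
    · subst hj; simpa using h3
    · rw [Function.update_of_ne hj]; exact h2 j
  · rw [Function.update_of_ne (by omega)]; exact h6
  · exact ⟨U l', h2 l', le_rfl⟩
  · simpa using h4
  · intro j
    unfold St.kap
    dsimp only
    split_ifs with hj
    · rw [hj]
    · rw [Function.update_of_ne hj]

theorem St.step (hh : 0 < h) (hn : 0 < n) (s : X.St h) : ∃ s' : X.St h, s'.l ≤ s.l + 1 ∧
    s.kap s.l = s'.kap s.l + 1 ∧ ∀ j, j ≠ s.l → s.kap j = s'.kap j := by
  have hk := s.hk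
  by_cases hc : X.dim (s.U s.l) < s.k - 1
  · obtain ⟨W, hW1, hW2⟩ := s.hW
    refine ⟨⟨s.q, s.U, s.l, s.k - 1, s.hq, s.hU, s.hmem, ⟨W, hW1, by omega⟩, hc⟩, by simp, ?_, ?_⟩
    · simp [St.kap]; omega
    · intro j hj
      simp [St.kap, hj]
  · obtain ⟨s', h1, h2⟩ := St.ofEvent X hh hn s.hq s.hU s.hmem
    refine ⟨s', h1, ?_, ?_⟩
    · rw [h2]; simp [St.kap]; omega
    · intro j hj
      rw [h2]; simp [St.kap, hj]

theorem St.init (hh : 0 < h) (hn : 0 < n) : Nonempty (X.St h) := by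
  choose U hU using fun j => X.exists_mini h j X.qs
  obtain ⟨J, hJ⟩ := X.exists_large hh (X.L X.qs (n - 1) + X.B)
  have := X.mini_top h (hU (J + 1)) (hJ _ (by omega))
  obtain ⟨s, -⟩ := St.ofEvent X hh hn (l := J) le_rfl hU (X.σtop _ this)
  exact ⟨s⟩

theorem main (hn2 : 2 ≤ n) {δ : ℝ} (hδ : 0 < δ) :
    ∃ (P : ℝ → Fin n → ℝ) (T0 : ℕ), IsNSystem n (Ici (δ * T0)) P ∧ IsRigid n δ (δ * T0) P ∧
      ∃ K, ∀ q ≥ δ * T0, ∀ i : Fin n, |P q i - X.L q i| ≤ K := by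
  have hn : 0 < n := by omega
  have hh : 0 < δ * n := by positivity
  obtain ⟨s0⟩ := St.init X hh hn
  choose nxt hn1 hn2' hn3 using fun s : X.St (δ * n) => s.step X hh hn
  let sq : ℕ → X.St (δ * n) := fun m => nxt^[m] s0
  have hsq : ∀ m, sq (m + 1) = nxt (sq m) := fun m => Function.iterate_succ_apply' _ _ _
  obtain ⟨P, T0, hA, hB, hC⟩ := rigid_of_coarse n hn2 δ hδ (fun s => (sq s).kap) (fun s => (sq s).l)
    (fun s => St.mono X hh _) (fun s w => St.le X _ _) (fun s => St.ev X hh _ hn)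
    (fun s => St.zero X _) (fun s => by rw [hsq]; exact hn2' _)
    (fun s w hw => by rw [hsq]; exact hn3 _ _ hw) (fun s => by rw [hsq]; exact hn1 _)
  refine ⟨P, T0, hA, hB, ?_⟩
  have hB0 : 0 ≤ X.B := by
    unfold B; have := X.hC; positivity
  set K := δ * n + 2 * X.B + 1 with hK
  refine ⟨δ * (3 * n + 1) + K + (n * K + X.C + δ * (3 * n + 1)), ?_⟩
  intro q hq i
  obtain ⟨s, p, h1, h2, h3, h4⟩ := hC q hq
  have hclose : ∀ i : Fin n, |X.L (sq s).q i - δ * p i| ≤ K := by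
    intro i
    have a1 := (sq s).lower X _ _ (h3 i)
    have a2 := (sq s).upper X _ _ (h4 i) i.2
    unfold xl at a1 a2
    have b1 : (n : ℝ) * ((p i / n : ℕ) : ℝ) ≤ p i := by exact_mod_cast Nat.mul_div_le _ _
    have b2 : (p i : ℝ) ≤ n * (((p i - 1) / n : ℕ) : ℝ) + n := by
      have := Nat.div_add_mod (p i - 1) n
      have := Nat.mod_lt (p i - 1) hn
      have : p i ≤ n * ((p i - 1) / n) + n := by omega
      exact_mod_cast this
    push_cast at a1
    have c1 := mul_le_mul_of_nonneg_left b1 hδ.le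
    have c2 := mul_le_mul_of_nonneg_left b2 hδ.le
    rw [abs_le]
    constructor <;> nlinarith
  have hsum : |(∑ j ∈ Finset.range n, X.L (sq s).q j) - δ * ((∑ i : Fin n, p i : ℕ) : ℝ)| ≤ n * K := by
    rw [Finset.sum_range, Nat.cast_sum, Finset.mul_sum, ← Finset.sum_sub_distrib]
    refine (Finset.abs_sum_le_sum_abs _ _).trans ?_
    refine (Finset.sum_le_sum fun i _ => hclose i).trans ?_
    simp
  have hLs := X.Lsum _ (sq s).hq
  have hqq : |q - (sq s).q| ≤ n * K + X.C + δ * (3 * n + 1) := by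
    rw [abs_le] at *
    constructor <;> linarith
  have hLq : |X.L (sq s).q i - X.L q i| ≤ |q - (sq s).q| := by
    rcases le_total q (sq s).q with hle | hle
    · have := X.Lle _ _ i hle
      have := X.Llip _ _ i hle
      rw [abs_of_nonneg (by linarith), abs_of_nonpos (by linarith)]
      linarith
    · have := X.Lle _ _ i hle
      have := X.Llip _ _ i hle
      rw [abs_of_nonpos (by linarith), abs_of_nonneg (by linarith)]
      linarith
  have := hclose i
  have := h2 i
  have hLq' := hLq.trans hqq
  clear hsum hLs hqq hLq h1
  rw [abs_le] at *
  constructor <;> linarith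

end FD

section MinkWrap
open MeasureTheory Module

section Mink
variable {F : Type} [NormedAddCommGroup F] [InnerProductSpace ℝ F] 

/-- The norm with unit ball `{‖x‖ ≤ 1, |⟪x, w⟫| ≤ e^{-q}}`. -/
def NN (w : F) (q : ℝ) (x : F) : ℝ := max ‖x‖ (Real.exp q * |⟪x, w⟫|)

def mm (w : F) (q : ℝ) : ℝ := max 1 (‖w‖ * Real.exp q)

def DD (w : F) (q : ℝ) : F →ₗ[ℝ] F :=
  LinearMap.transvection ((mm w q - 1) • (innerₛₗ ℝ (‖w‖⁻¹ • w))) (‖w‖⁻¹ • w)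

theorem DD_apply (w : F) (q : ℝ) (x : F) :
    DD w q x = x + ((mm w q - 1) * ⟪‖w‖⁻¹ • w, x⟫) • (‖w‖⁻¹ • w) := by
  unfold DD
  rw [LinearMap.transvection.apply]
  simp only [LinearMap.smul_apply, innerₛₗ_apply_apply, smul_eq_mul]

theorem one_le_mm (w : F) (q : ℝ) : 1 ≤ mm w q := le_max_left _ _

theorem DD_det [FiniteDimensional ℝ F] (w : F) (q : ℝ) : LinearMap.det (DD w q) = mm w q := by
  unfold DD
  rw [LinearMap.transvection.det]
  simp only [LinearMap.smul_apply, innerₛₗ_apply_apply, smul_eq_mul]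
  rw [real_inner_self_eq_norm_sq]
  by_cases hw : w = 0
  · simp [hw, mm]
  · have : ‖‖w‖⁻¹ • w‖ = 1 := by
      rw [norm_smul, norm_inv, norm_norm, inv_mul_cancel₀ (norm_ne_zero_iff.2 hw)]
    rw [this]; ring

theorem DD_le (w : F) (q : ℝ) (x : F) : ‖DD w q x‖ ≤ 2 * NN w q x := by
  rw [DD_apply]
  have h1 : ‖x‖ ≤ NN w q x := le_max_left _ _
  have h2 : Real.exp q * |⟪x, w⟫| ≤ NN w q x := le_max_right _ _
  have h3 : ‖((mm w q - 1) * ⟪‖w‖⁻¹ • w, x⟫) • (‖w‖⁻¹ • w)‖ ≤ Real.exp q * |⟪x, w⟫| := by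
    by_cases hw : w = 0
    · simp [hw]
    have hp : ‖‖w‖⁻¹ • w‖ = 1 := by
      rw [norm_smul, norm_inv, norm_norm, inv_mul_cancel₀ (norm_ne_zero_iff.2 hw)]
    rw [norm_smul, hp, mul_one, norm_mul, real_inner_smul_left, real_inner_comm, norm_mul, norm_inv,
      norm_norm, Real.norm_eq_abs, Real.norm_eq_abs]
    have hw' : 0 < ‖w‖ := norm_pos_iff.2 hw
    have h4 : |mm w q - 1| ≤ ‖w‖ * Real.exp q := by
      rw [abs_of_nonneg (by linarith [one_le_mm w q])]
      unfold mm
      have : 0 ≤ ‖w‖ * Real.exp q := by positivity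
      have : max 1 (‖w‖ * Real.exp q) ≤ 1 + ‖w‖ * Real.exp q := max_le (by linarith) (by linarith)
      linarith
    calc |mm w q - 1| * (‖w‖⁻¹ * |⟪x, w⟫|) ≤ (‖w‖ * Real.exp q) * (‖w‖⁻¹ * |⟪x, w⟫|) := by gcongr
      _ = _ := by field_simp
  have := norm_add_le x (((mm w q - 1) * ⟪‖w‖⁻¹ • w, x⟫) • (‖w‖⁻¹ • w))
  linarith

theorem le_DD (w : F) (q : ℝ) (x : F) : NN w q x ≤ ‖DD w q x‖ := by
  have hm := one_le_mm w q
  by_cases hw : w = 0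
  · rw [DD_apply]; simp [hw, NN]
  have hw' : 0 < ‖w‖ := norm_pos_iff.2 hw
  have hp : ‖‖w‖⁻¹ • w‖ = 1 := by
    rw [norm_smul, norm_inv, norm_norm, inv_mul_cancel₀ (norm_ne_zero_iff.2 hw)]
  unfold NN
  have hwx : ⟪x, w⟫ = ‖w‖ * ⟪‖w‖⁻¹ • w, x⟫ := by
    rw [real_inner_smul_left, real_inner_comm]; field_simp
  rw [hwx, DD_apply]
  set p := ‖w‖⁻¹ • w
  set t := ⟪p, x⟫ with ht
  apply max_le
  · rw [← sq_le_sq₀ (norm_nonneg _) (norm_nonneg _), norm_add_sq_real, inner_smul_right,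
      real_inner_comm, ← ht]
    have : 0 ≤ (mm w q - 1) * t * t := by
      rw [mul_assoc]; exact mul_nonneg (by linarith) (mul_self_nonneg _)
    nlinarith [sq_nonneg ‖((mm w q - 1) * t) • p‖]
  · have h1 : ⟪p, x + ((mm w q - 1) * t) • p⟫ = mm w q * t := by
      rw [inner_add_right, inner_smul_right, real_inner_self_eq_norm_sq, hp, ← ht]; ring
    have h2 := abs_real_inner_le_norm p (x + ((mm w q - 1) * t) • p)
    rw [h1, hp, one_mul, abs_mul, abs_of_pos (by linarith)] at h2
    refine le_trans ?_ h2
    rw [abs_mul, abs_norm, ← mul_assoc, mul_comm (Real.exp q)]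
    gcongr
    exact le_max_right _ _

variable [FiniteDimensional ℝ F]

theorem abs_det_orthonormal {k : ℕ} (o e : OrthonormalBasis (Fin k) ℝ F) (v : Fin k → F) :
    |o.toBasis.det v| = |e.toBasis.det v| := by
  have h := AlternatingMap.eq_smul_basis_det e.toBasis o.toBasis.det
  rw [h, AlternatingMap.smul_apply, smul_eq_mul, abs_mul]
  have := o.det_to_matrix_orthonormalBasis_real e
  have h2 : |o.toBasis.det e.toBasis| = 1 := by
    rw [e.coe_toBasis]
    rcases this with h | h <;> rw [h] <;> simp
  rw [h2, one_mul]

theorem hadamard_ineq {k : ℕ} (o : OrthonormalBasis (Fin k) ℝ F) (v : Fin k → F) :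
    |o.toBasis.det v| ≤ ∏ i, ‖v i‖ := by
  have hk : finrank ℝ F = Fintype.card (Fin k) := finrank_eq_card_basis o.toBasis
  rw [abs_det_orthonormal o (InnerProductSpace.gramSchmidtOrthonormalBasis hk v),
    InnerProductSpace.gramSchmidtOrthonormalBasis_det, Finset.abs_prod]
  apply Finset.prod_le_prod
  · intro i _; positivity
  · intro i _
    have := abs_real_inner_le_norm (InnerProductSpace.gramSchmidtOrthonormalBasis hk v i) (v i)
    rwa [OrthonormalBasis.norm_eq_one, one_mul] at this

theorem mink_lower {k : ℕ} (o : OrthonormalBasis (Fin k) ℝ F) (b : Basis (Fin k) ℝ F)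
    (w : F) (q : ℝ) (z : Fin k → F) (hz : LinearIndependent ℝ z)
    (hzb : ∀ i, z i ∈ Submodule.span ℤ (range b)) :
    |o.toBasis.det b| * mm w q ≤ 2 ^ k * ∏ i, NN w q (z i) := by
  have h1 := hadamard_ineq o (DD w q ∘ z)
  rw [Basis.det_comp, DD_det, abs_mul, abs_of_nonneg (by linarith [one_le_mm w q])] at h1
  have h2 := AlternatingMap.eq_smul_basis_det b o.toBasis.det
  rw [h2, AlternatingMap.smul_apply, smul_eq_mul, abs_mul] at h1
  have hne : b.det z ≠ 0 := by
    have hk : finrank ℝ F = k := by simpa using finrank_eq_card_basis b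
    have : IsUnit (b.det z) := by
      rw [← Basis.is_basis_iff_det]
      exact ⟨hz, hz.span_eq_top_of_card_eq_finrank' (by simp [hk])⟩
    exact this.ne_zero
  have hzint : ∃ m : ℤ, b.det z = m := by
    have : ∀ i j, ∃ m : ℤ, b.repr (z i) j = m := by
      intro i j
      obtain ⟨m, hm⟩ := (b.mem_span_iff_repr_mem ℤ (z i)).1 (hzb i) j
      exact ⟨m, by rw [← hm]; simp⟩
    choose A hA using this
    refine ⟨(Matrix.of fun i j => A j i).det, ?_⟩
    rw [Basis.det_apply]
    rw [show ((Matrix.of fun i j => A j i).det : ℝ) = Int.castRingHom ℝ (Matrix.of fun i j => A j i).det from rfl, RingHom.map_det]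
    congr 1
    ext i j
    simp [Basis.toMatrix_apply, hA]
  have hge : 1 ≤ |b.det z| := by
    obtain ⟨m, hm⟩ := hzint
    rw [hm] at hne ⊢
    have : m ≠ 0 := by exact_mod_cast hne
    exact_mod_cast Int.one_le_abs this
  have h3 : ∏ i, ‖(DD w q ∘ z) i‖ ≤ 2 ^ k * ∏ i, NN w q (z i) := by
    calc _ ≤ ∏ i : Fin k, 2 * NN w q (z i) :=
          Finset.prod_le_prod (fun i _ => norm_nonneg _) (fun i _ => DD_le w q (z i))
      _ = _ := by rw [Finset.prod_mul_distrib]; simp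
  refine le_trans ?_ (h1.trans h3)
  have h5 : 0 ≤ mm w q := by linarith [one_le_mm w q]
  have h6 : 0 ≤ |o.toBasis.det b| := abs_nonneg _
  rw [mul_comm]
  gcongr
  nlinarith

theorem box_volume [MeasurableSpace F] [BorelSpace F] {k : ℕ} (e : OrthonormalBasis (Fin k) ℝ F) (r : Fin k → ℝ)  :
    volume {y : F | ∀ i, |⟪e i, y⟫| < r i} = ∏ i, ENNReal.ofReal (2 * r i) := by
  have h1 : {y : F | ∀ i, |⟪e i, y⟫| < r i} =
      e.repr ⁻¹' ((WithLp.ofLp) ⁻¹' (Set.pi univ fun i => Ioo (-r i) (r i))) := by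
    ext y
    simp [abs_lt, OrthonormalBasis.repr_apply_apply]
  have hm : MeasurableSet (Set.pi univ fun i => Ioo (-r i) (r i)) :=
    MeasurableSet.univ_pi fun i => measurableSet_Ioo
  rw [h1, e.measurePreserving_repr.measure_preimage, 
    (PiLp.volume_preserving_ofLp (Fin k)).measure_preimage hm.nullMeasurableSet, volume_pi_pi]
  · congr 1; ext i; rw [Real.volume_Ioo]; ring_nf
  · exact ((PiLp.volume_preserving_ofLp (Fin k)).measurable hm).nullMeasurableSet

theorem mink_upper {k : ℕ} (o : OrthonormalBasis (Fin k) ℝ F) (b : Basis (Fin k) ℝ F)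
    (w : F) (q : ℝ) (z : Fin k → F) 
    (hmono : Monotone fun i => NN w q (z i))
    (hmin : ∀ (j : Fin k) x, x ∈ Submodule.span ℤ (range b) →
      x ∉ Submodule.span ℝ (z '' Iio j) → NN w q (z j) ≤ NN w q x) :
    ∏ i, NN w q (z i) ≤ (k : ℝ) ^ k * (|o.toBasis.det b| * mm w q) := by
  borelize F
  have hm := one_le_mm w q
  have hk : finrank ℝ F = Fintype.card (Fin k) := finrank_eq_card_basis o.toBasis
  set v := DD w q ∘ z with hv
  set e := InnerProductSpace.gramSchmidtOrthonormalBasis hk v with he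
  set K : Set F := (DD w q) ⁻¹' {y : F | ∀ i, |⟪e i, y⟫| < NN w q (z i) / k} with hK
  have hdet : LinearMap.det (DD w q) ≠ 0 := by rw [DD_det]; linarith
  have hNN0 : ∀ x, 0 ≤ NN w q x := fun x => (norm_nonneg x).trans (le_max_left _ _)
  have hvol : volume K = ENNReal.ofReal ((mm w q)⁻¹ * ∏ i, (2 * (NN w q (z i) / k))) := by
    rw [hK, Measure.addHaar_preimage_linearMap _ hdet, box_volume, DD_det,
      abs_of_nonneg (by positivity), ENNReal.ofReal_mul (by positivity), ENNReal.ofReal_prod_of_nonneg]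
    intro i _
    have := hNN0 (z i)
    positivity
  have hconv : Convex ℝ K := by
    rw [hK]
    apply Convex.linear_preimage
    intro x hx y hy s t hs ht hst i
    have h1 := hx i
    have h2 := hy i
    rw [inner_add_right, inner_smul_right, inner_smul_right]
    rw [abs_lt] at *
    rcases eq_or_lt_of_le hs with rfl | hs'
    · rw [zero_add] at hst; subst hst; simp; exact h2
    · constructor <;> nlinarith
  have hsymm : ∀ x ∈ K, -x ∈ K := by
    intro x hx i
    have := hx i
    rw [map_neg, inner_neg_right, abs_neg]
    exact this
  have hfund : volume (ZSpan.fundamentalDomain b) = ENNReal.ofReal |o.toBasis.det b| := by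
    rw [ZSpan.measure_fundamentalDomain b volume o.toBasis,
      measure_congr (ZSpan.fundamentalDomain_ae_parallelepiped o.toBasis volume)]
    rw [o.coe_toBasis, o.volume_parallelepiped, mul_one]
  by_contra hc
  push Not at hc
  have hlt : volume (ZSpan.fundamentalDomain b) * 2 ^ finrank ℝ F < volume K := by
    rw [hfund, hvol, hk, Fintype.card_fin]
    rw [show (2 : ENNReal) ^ k = ENNReal.ofReal (2 ^ k) by simp [ENNReal.ofReal_pow],
      ← ENNReal.ofReal_mul (abs_nonneg _)]
    have hkk : (0 : ℝ) < (k : ℝ) ^ k := by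
      rcases Nat.eq_zero_or_pos k with h0 | h0
      · simp [h0]
      · positivity
    have e1 : ∏ i, (2 * (NN w q (z i) / k)) = 2 ^ k * (∏ i, NN w q (z i)) / (k : ℝ) ^ k := by
      rw [Finset.prod_mul_distrib, Finset.prod_div_distrib]
      simp
      ring
    have e2 : |o.toBasis.det b| * 2 ^ k < (mm w q)⁻¹ * ∏ i, (2 * (NN w q (z i) / k)) := by
      rw [e1, ← div_eq_inv_mul, lt_div_iff₀ (by linarith), lt_div_iff₀ hkk]
      have := mul_lt_mul_of_pos_left hc (show (0:ℝ) < 2 ^ k by positivity)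
      nlinarith
    rw [ENNReal.ofReal_lt_ofReal_iff_of_nonneg (by positivity)]
    exact e2
  have hcount : Countable (Submodule.span ℤ (range b)).toAddSubgroup := by
    change Countable (Submodule.span ℤ (range b))
    infer_instance
  obtain ⟨⟨x, hxL⟩, hx0, hxK⟩ := exists_ne_zero_mem_lattice_of_measure_mul_two_pow_lt_measure
    (ZSpan.isAddFundamentalDomain' b volume) hsymm hconv hlt
  have hx0' : x ≠ 0 := fun h => hx0 (Subtype.ext h)
  change x ∈ K at hxK
  have hDx : DD w q x ≠ 0 := by
    intro h
    have h1 := le_DD w q x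
    have h2 : ‖x‖ ≤ NN w q x := le_max_left _ _
    rw [h, norm_zero] at h1
    exact hx0' (norm_le_zero_iff.1 (h2.trans h1))
  classical
  set T := Finset.univ.filter fun i => ⟪e i, DD w q x⟫ ≠ 0 with hT
  have hTne : T.Nonempty := by
    by_contra hne
    rw [Finset.not_nonempty_iff_eq_empty] at hne
    apply hDx
    rw [← e.sum_repr' (DD w q x)]
    apply Finset.sum_eq_zero
    intro i _
    have : i ∉ T := by rw [hne]; simp
    simp only [hT, Finset.mem_filter, Finset.mem_univ, true_and, not_not] at this
    rw [this, zero_smul]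
  set j := T.max' hTne with hj
  have hjT : ⟪e j, DD w q x⟫ ≠ 0 := by
    have := T.max'_mem hTne
    simpa [hT] using this
  have hjmax : ∀ i, ⟪e i, DD w q x⟫ ≠ 0 → i ≤ j := fun i hi => T.le_max' i (by simp [hT, hi])
  have hnot : x ∉ Submodule.span ℝ (z '' Iio j) := by
    intro hx
    apply hjT
    have : Submodule.span ℝ (z '' Iio j) ≤ LinearMap.ker ((innerₛₗ ℝ (e j)) ∘ₗ (DD w q)) := by
      rw [Submodule.span_le]
      rintro _ ⟨i, hi, rfl⟩
      have := InnerProductSpace.gramSchmidtOrthonormalBasis_inv_triangular hk v (show i < j from hi)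
      change ⟪e j, DD w q (z i)⟫ = 0
      exact this
    have := this hx
    simpa using this
  have h1 := hmin j x hxL hnot
  have h2 := le_DD w q x
  have h3 : ‖DD w q x‖ ≤ ∑ i, |⟪e i, DD w q x⟫| := by
    conv_lhs => rw [← e.sum_repr' (DD w q x)]
    refine (norm_sum_le _ _).trans (Finset.sum_le_sum fun i _ => ?_)
    rw [norm_smul, e.norm_eq_one, mul_one]
    rfl
  have hk0 : (0:ℝ) < k := by
    have : 0 < k := lt_of_le_of_lt (Nat.zero_le _) j.2
    exact_mod_cast this
  have h4 : ∑ i, |⟪e i, DD w q x⟫| < ∑ i : Fin k, NN w q (z j) / k := by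
    have hle : ∀ i, |⟪e i, DD w q x⟫| ≤ NN w q (z j) / k := by
      intro i
      by_cases hi : ⟪e i, DD w q x⟫ = 0
      · rw [hi, abs_zero]; have := hNN0 (z j); positivity
      · have h5 := hxK i
        have h6 : NN w q (z i) ≤ NN w q (z j) := hmono (hjmax i hi)
        refine h5.le.trans ?_
        gcongr
    exact Finset.sum_lt_sum (fun i _ => hle i) ⟨j, Finset.mem_univ _, hxK j⟩
  rw [Finset.sum_const, Finset.card_univ, Fintype.card_fin, nsmul_eq_mul,
    mul_div_cancel₀ _ hk0.ne'] at h4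
  linarith

theorem mink_log (n : ℕ) {k : ℕ} (hkn : k ≤ n) (b : Basis (Fin k) ℝ F) : ∃ a : ℝ,
    ∀ (w : F) (q : ℝ) (z : Fin k → F), LinearIndependent ℝ z →
    (∀ i, z i ∈ Submodule.span ℤ (range b)) →
    (Monotone fun i => NN w q (z i)) →
    (∀ (j : Fin k) x, x ∈ Submodule.span ℤ (range b) →
      x ∉ Submodule.span ℝ (z '' Iio j) → NN w q (z j) ≤ NN w q x) →
    |(∑ i, Real.log (NN w q (z i))) - (a + lam ‖w‖ q)| ≤ n * Real.log 2 + n * Real.log n := by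
  have hk : finrank ℝ F = k := by simpa using finrank_eq_card_basis b
  let o : OrthonormalBasis (Fin k) ℝ F := (stdOrthonormalBasis ℝ F).reindex (finCongr hk)
  refine ⟨Real.log |o.toBasis.det b|, ?_⟩
  intro w q z hz hzb hmono hmin
  have h1 := mink_lower o b w q z hz hzb
  have h2 := mink_upper o b w q z hmono hmin
  have hpos : ∀ i, 0 < NN w q (z i) := fun i =>
    lt_of_lt_of_le (norm_pos_iff.2 (hz.ne_zero i)) (le_max_left _ _)
  have hc : 0 < |o.toBasis.det b| := abs_pos.2 (o.toBasis.isUnit_det b).ne_zero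
  have hm : 0 < mm w q := by linarith [one_le_mm w q]
  have hP : 0 < ∏ i, NN w q (z i) := Finset.prod_pos fun i _ => hpos i
  have hkk : (0 : ℝ) < (k : ℝ) ^ k := by
    rcases Nat.eq_zero_or_pos k with h0 | h0
    · simp [h0]
    · positivity
  have g1 := Real.log_le_log (by positivity) h1
  have g2 := Real.log_le_log hP h2
  rw [Real.log_mul hc.ne' hm.ne', Real.log_mul (by positivity) hP.ne', Real.log_pow] at g1
  rw [Real.log_mul hkk.ne' (by positivity), Real.log_mul hc.ne' hm.ne', Real.log_pow] at g2
  rw [Real.log_prod (fun i _ => (hpos i).ne')] at g1 g2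
  have hl2 : 0 ≤ Real.log 2 := Real.log_nonneg (by norm_num)
  have hkn' : (k : ℝ) ≤ n := by exact_mod_cast hkn
  have i1 : (k : ℝ) * Real.log 2 ≤ n * Real.log 2 := by gcongr
  have hln : 0 ≤ Real.log n := Real.log_natCast_nonneg n
  have i2 : (k : ℝ) * Real.log k ≤ n * Real.log n := by
    rcases Nat.eq_zero_or_pos k with h0 | h0
    · simp [h0]; positivity
    · have : Real.log k ≤ Real.log n := Real.log_le_log (by exact_mod_cast h0) hkn'
      gcongr
  have i3 : (0:ℝ) ≤ n * Real.log 2 := by positivity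
  have i4 : (0:ℝ) ≤ n * Real.log n := by positivity
  have e : lam ‖w‖ q = Real.log (mm w q) := rfl
  rw [e, abs_le]
  constructor <;> linarith

end Mink
end MinkWrap

section MinSys
variable {n : ℕ}

abbrev EE (n : ℕ) := EuclideanSpace ℝ (Fin n)

def LL (n : ℕ) : Submodule ℤ (EE n) :=
  Submodule.span ℤ (range (EuclideanSpace.basisFun (Fin n) ℝ).toBasis)

theorem mem_LL (x : EE n) : x ∈ LL n ↔ ∀ k, ∃ m : ℤ, x k = (m : ℝ) := by
  unfold LL
  rw [Module.Basis.mem_span_iff_repr_mem]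
  simp [eq_comm]

theorem LL_span_top : Submodule.span ℝ (LL n : Set (EE n)) = ⊤ := by
  rw [eq_top_iff, ← (EuclideanSpace.basisFun (Fin n) ℝ).toBasis.span_eq]
  exact Submodule.span_mono Submodule.subset_span

theorem LL_fin (R : ℝ) : {x : EE n | x ∈ LL n ∧ ‖x‖ ≤ R}.Finite := by
  have := ZSpan.setFinite_inter (EuclideanSpace.basisFun (Fin n) ℝ).toBasis
    (Metric.isBounded_closedBall (x := (0 : EE n)) (r := R))
  refine this.subset ?_
  intro x hx
  exact ⟨by simpa using hx.2, hx.1⟩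

theorem LL_norm (x : EE n) (hx : x ∈ LL n) (h0 : x ≠ 0) : 1 ≤ ‖x‖ := by
  rw [mem_LL] at hx
  obtain ⟨k, hk⟩ : ∃ k, x k ≠ 0 := by
    by_contra! h
    exact h0 (by ext k; simpa using h k)
  obtain ⟨m, hm⟩ := hx k
  have h1 : ‖x k‖ ≤ ‖x‖ := PiLp.norm_apply_le x k
  refine le_trans ?_ h1
  rw [hm] at hk ⊢
  rw [Real.norm_eq_abs]
  have : m ≠ 0 := by
    rintro rfl
    exact hk Int.cast_zero
  exact_mod_cast Int.one_le_abs this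

instance : DiscreteTopology (LL n) := by unfold LL; infer_instance

def sp (z : ℕ → EE n) (k : ℕ) : Submodule ℝ (EE n) := Submodule.span ℝ (z '' Iio k)

theorem mem_sp (z : ℕ → EE n) {j k : ℕ} (h : j < k) : z j ∈ sp z k :=
  Submodule.subset_span ⟨j, h, rfl⟩

theorem sp_mono (z : ℕ → EE n) {j k : ℕ} (h : j ≤ k) : sp z j ≤ sp z k :=
  Submodule.span_mono (image_mono (Iio_subset_Iio h))

theorem sp_congr {z z' : ℕ → EE n} {k : ℕ} (h : ∀ j < k, z j = z' j) : sp z k = sp z' k := by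
  unfold sp
  congr 1
  exact image_congr h

theorem sp_range (z : ℕ → EE n) (k : ℕ) : range (fun i : Fin k => z i) = z '' Iio k := by
  ext x
  constructor
  · rintro ⟨i, rfl⟩
    exact ⟨i, i.2, rfl⟩
  · rintro ⟨i, hi, rfl⟩
    exact ⟨⟨i, hi⟩, rfl⟩

theorem sp_li (z : ℕ → EE n) (k : ℕ) (h : ∀ j < k, z j ∉ sp z j) :
    LinearIndependent ℝ (fun i : Fin k => z i) := by
  induction k with
  | zero => exact linearIndependent_empty_type
  | succ k ih =>
    rw [linearIndependent_finSucc']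
    refine ⟨ih fun j hj => h j (by omega), ?_⟩
    have := h k (by omega)
    have e : range (Fin.init fun i : Fin (k+1) => z i) = z '' Iio k := sp_range z k
    rw [e]
    exact this

theorem sp_finrank (z : ℕ → EE n) (k : ℕ) (h : ∀ j < k, z j ∉ sp z j) :
    Module.finrank ℝ (sp z k) = k := by
  have := finrank_span_eq_card (sp_li z k h)
  rw [sp_range] at this
  rw [Fintype.card_fin] at this
  exact this

structure MS (u : EE n) (V : Submodule ℝ (EE n)) (q : ℝ) (k : ℕ) (z : ℕ → EE n) : Prop where
  mem : ∀ j < k, z j ∈ V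
  lat : ∀ j < k, z j ∈ LL n
  ni : ∀ j < k, z j ∉ sp z j
  min : ∀ j < k, ∀ x ∈ V, x ∈ LL n → x ∉ sp z j → NN u q (z j) ≤ NN u q x

theorem sp_le {V : Submodule ℝ (EE n)} {z : ℕ → EE n} {k : ℕ} (h : ∀ j < k, z j ∈ V) : sp z k ≤ V := by
  unfold sp
  rw [Submodule.span_le]
  rintro _ ⟨i, hi, rfl⟩
  exact h i hi

theorem MS.mono {u : EE n} {V : Submodule ℝ (EE n)} {q : ℝ} {k : ℕ} {z : ℕ → EE n}
    (h : MS u V q k z) {i j : ℕ} (hij : i ≤ j) (hj : j < k) : NN u q (z i) ≤ NN u q (z j) :=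
  h.min i (by omega) _ (h.mem j hj) (h.lat j hj) (fun hh => h.ni j hj (sp_mono z hij hh))

theorem MS.trunc {u : EE n} {q : ℝ} {k m : ℕ} {z : ℕ → EE n}
    (h : MS u ⊤ q m z) (hk : k ≤ m) : MS u (sp z k) q k z where
  mem j hj := mem_sp z hj
  lat j hj := h.lat j (by omega)
  ni j hj := h.ni j (by omega)
  min j hj x _ := h.min j (by omega) x trivial

theorem MS.one_le {u : EE n} {V : Submodule ℝ (EE n)} {q : ℝ} {k : ℕ} {z : ℕ → EE n}
    (h : MS u V q k z) {j : ℕ} (hj : j < k) : 1 ≤ NN u q (z j) := by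
  refine le_trans (LL_norm _ (h.lat j hj) ?_) (le_max_left _ _)
  intro h0
  apply h.ni j hj
  rw [h0]
  exact Submodule.zero_mem _

/-- Rational subspaces. -/
def Rat' (V : Submodule ℝ (EE n)) : Prop := Submodule.span ℝ ((V : Set (EE n)) ∩ LL n) = V

theorem sp_rat {z : ℕ → EE n} {k : ℕ} (h : ∀ j < k, z j ∈ LL n) : Rat' (sp z k) := by
  apply le_antisymm
  · rw [Submodule.span_le]
    exact inter_subset_left
  · unfold sp
    apply Submodule.span_mono
    rintro _ ⟨i, hi, rfl⟩
    exact ⟨mem_sp z hi, h i hi⟩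

theorem top_rat : Rat' (⊤ : Submodule ℝ (EE n)) := by
  unfold Rat'
  simp [LL_span_top]

theorem exists_min (u : EE n) (q : ℝ) (T : Set (EE n)) (hT : T ⊆ LL n) (h0 : T.Nonempty) :
    ∃ x ∈ T, ∀ y ∈ T, NN u q x ≤ NN u q y := by
  obtain ⟨x0, hx0⟩ := h0
  have hf : {x | x ∈ T ∧ NN u q x ≤ NN u q x0}.Finite := by
    refine (LL_fin (NN u q x0)).subset ?_
    rintro x ⟨h1, h2⟩
    exact ⟨hT h1, (le_max_left _ _).trans h2⟩
  obtain ⟨x, hx, hm⟩ := Set.exists_min_image _ (NN u q) hf ⟨x0, hx0, le_rfl⟩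
  refine ⟨x, hx.1, fun y hy => ?_⟩
  rcases le_total (NN u q y) (NN u q x0) with h | h
  · exact hm y ⟨hy, h⟩
  · exact hx.2.trans h

theorem MS_exists (u : EE n) {V : Submodule ℝ (EE n)} (hV : Rat' V) (q : ℝ) (k : ℕ)
    (hk : k ≤ Module.finrank ℝ V) : ∃ z, MS u V q k z := by
  induction k with
  | zero => exact ⟨fun _ => 0, ⟨by simp, by simp, by simp, by simp⟩⟩
  | succ k ih =>
    obtain ⟨z, hz⟩ := ih (by omega)
    have hne : ∃ x ∈ (V : Set (EE n)) ∩ LL n, x ∉ sp z k := by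
      by_contra! h
      have : V ≤ sp z k := by
        rw [← hV, Submodule.span_le]
        exact h
      have := Submodule.finrank_mono this
      rw [sp_finrank z k hz.ni] at this
      omega
    obtain ⟨x0, hx0, hx0'⟩ := hne
    obtain ⟨x, hx, hmin⟩ := exists_min u q {x | x ∈ V ∧ x ∈ LL n ∧ x ∉ sp z k} (fun x hx => hx.2.1)
      ⟨x0, hx0.1, hx0.2, hx0'⟩
    refine ⟨Function.update z k x, ?_⟩
    have hs : ∀ j ≤ k, sp (Function.update z k x) j = sp z j := by
      intro j hj
      apply sp_congr
      intro i hi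
      rw [Function.update_of_ne (by omega)]
    constructor
    · intro j hj
      rcases eq_or_ne j k with rfl | h
      · simpa using hx.1
      · rw [Function.update_of_ne h]; exact hz.mem j (by omega)
    · intro j hj
      rcases eq_or_ne j k with rfl | h
      · simpa using hx.2.1
      · rw [Function.update_of_ne h]; exact hz.lat j (by omega)
    · intro j hj
      rw [hs j (by omega)]
      rcases eq_or_ne j k with rfl | h
      · simpa using hx.2.2
      · rw [Function.update_of_ne h]; exact hz.ni j (by omega)
    · intro j hj
      rw [hs j (by omega)]
      rcases eq_or_ne j k with rfl | h
      · intro y h1 h2 h3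
        simpa using hmin y ⟨h1, h2, h3⟩
      · rw [Function.update_of_ne h]; exact hz.min j (by omega)

theorem MS.cmp {u : EE n} {V : Submodule ℝ (EE n)} {q : ℝ} {k : ℕ} {z w : ℕ → EE n}
    (hz : MS u ⊤ q n z) (hw : MS u V q k w) {j : ℕ} (hj : j < k) (hjn : j < n) :
    NN u q (z j) ≤ NN u q (w j) := by
  obtain ⟨i, hi, hi'⟩ : ∃ i ≤ j, w i ∉ sp z j := by
    by_contra! h
    have h1 : sp w (j+1) ≤ sp z j := sp_le fun i hi => h i (by omega)
    have := Submodule.finrank_mono h1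
    rw [sp_finrank w _ fun i hi => hw.ni i (by omega), sp_finrank z _ fun i hi => hz.ni i (by omega)] at this
    omega
  exact (hz.min j hjn _ trivial (hw.lat i (by omega)) hi').trans (hw.mono hi hj)

theorem MS.cmp' {u : EE n} {V : Submodule ℝ (EE n)} {q : ℝ} {k : ℕ} {z w : ℕ → EE n}
    (hz : MS u ⊤ q n z) (hw : MS u V q k w) (hk : Module.finrank ℝ V = k) (hkn : k ≤ n)
    (hne : V ≠ sp z k) :
    0 < k ∧ k < n ∧ NN u q (z k) ≤ NN u q (w (k-1)) := by
  have hVw : sp w k = V := Submodule.eq_of_le_of_finrank_eq (sp_le hw.mem)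
    (by rw [sp_finrank w k hw.ni, hk])
  have h0 : 0 < k := by
    rcases Nat.eq_zero_or_pos k with h | h
    · subst h
      exfalso; apply hne
      rw [← hVw]
      simp [sp]
    · exact h
  have hn : k < n := by
    rcases eq_or_lt_of_le hkn with h | h
    · exfalso; apply hne
      have e1 : V = ⊤ := Submodule.eq_top_of_finrank_eq (by rw [hk, h]; simp)
      have e2 : sp z k = ⊤ := Submodule.eq_top_of_finrank_eq
        (by rw [sp_finrank z k fun i hi => hz.ni i (by omega), h]; simp)
      rw [e1, e2]
    · exact h
  refine ⟨h0, hn, ?_⟩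
  obtain ⟨i, hi, hi'⟩ : ∃ i < k, w i ∉ sp z k := by
    by_contra! h
    have h1 : sp w k ≤ sp z k := sp_le h
    apply hne
    rw [← hVw]
    exact Submodule.eq_of_le_of_finrank_eq h1 (by
      rw [sp_finrank w k hw.ni, sp_finrank z k fun i hi => hz.ni i (by omega)])
  exact (hz.min k hn _ trivial (hw.lat i (by omega)) hi').trans (hw.mono (by omega) (by omega))

/-- exchange of different parameters -/
theorem MS.exch {u : EE n} {q q' : ℝ} {z w : ℕ → EE n}
    (hz : MS u ⊤ q n z) (hw : MS u ⊤ q' n w) {j : ℕ} (hj : j < n) :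
    ∃ i ≤ j, NN u q (z j) ≤ NN u q (w i) := by
  obtain ⟨i, hi, hi'⟩ : ∃ i ≤ j, w i ∉ sp z j := by
    by_contra! h
    have h1 : sp w (j+1) ≤ sp z j := sp_le fun i hi => h i (by omega)
    have := Submodule.finrank_mono h1
    rw [sp_finrank w _ fun i hi => hw.ni i (by omega), sp_finrank z _ fun i hi => hz.ni i (by omega)] at this
    omega
  exact ⟨i, hi, hz.min j hj _ trivial (hw.lat i (by omega)) hi'⟩

theorem NN_mono (u x : EE n) {q q' : ℝ} (h : q ≤ q') : NN u q x ≤ NN u q' x := by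
  unfold NN
  gcongr

theorem NN_lip (u x : EE n) {q q' : ℝ} (h : q ≤ q') : NN u q' x ≤ Real.exp (q' - q) * NN u q x := by
  unfold NN
  have h1 : 1 ≤ Real.exp (q' - q) := Real.one_le_exp (by linarith)
  apply max_le
  · nlinarith [le_max_left ‖x‖ (Real.exp q * |⟪x, u⟫|), norm_nonneg x]
  · have : Real.exp q' = Real.exp (q' - q) * Real.exp q := by rw [← Real.exp_add]; ring_nf
    rw [this, mul_assoc]
    gcongr
    exact le_max_right _ _

theorem MS.lamMin_eq {u : EE n} {q : ℝ} {z : ℕ → EE n}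
    (hz : MS u ⊤ q n z) {j : ℕ} (hj : j < n) : lamMin n u q (j+1) = NN u q (z j) := by
  unfold lamMin
  have key : ∀ (x : EE n) (t : ℝ), (‖x‖ ≤ t ∧ |⟪x, u⟫| ≤ t * Real.exp (-q)) ↔ NN u q x ≤ t := by
    intro x t
    unfold NN
    rw [max_le_iff, Real.exp_neg, ← div_eq_mul_inv, le_div_iff₀ (Real.exp_pos q), mul_comm (Real.exp q)]
  apply IsLeast.csInf_eq
  constructor
  · refine ⟨hz.one_le hj, fun i => z i, sp_li z _ fun i hi => hz.ni i (by omega), ?_⟩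
    intro i
    refine ⟨(mem_LL _).1 (hz.lat i (by omega)), ?_⟩
    rw [key]
    exact hz.mono (by omega) hj
  · rintro t ⟨_, v, hv, hvv⟩
    obtain ⟨i, hi⟩ : ∃ i, v i ∉ sp z j := by
      by_contra! h
      have h1 : Submodule.span ℝ (range v) ≤ sp z j := by
        rw [Submodule.span_le]; rintro _ ⟨i, rfl⟩; exact h i
      have := Submodule.finrank_mono h1
      rw [finrank_span_eq_card hv, sp_finrank z _ fun i hi => hz.ni i (by omega)] at this
      simp at this
    exact (hz.min j hj _ trivial ((mem_LL _).2 (hvv i).1) hi).trans ((key _ _).1 (hvv i).2)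

end MinSys

section Assemble
variable {n : ℕ}

theorem NN_proj (u : EE n) (V : Submodule ℝ (EE n)) (q : ℝ) (x : V) :
    NN (V.orthogonalProjectionOnto u) q x = NN u q (x : EE n) := by
  unfold NN
  rw [Submodule.inner_orthogonalProjectionOnto_eq_of_mem_left]
  rfl

theorem lattice_basis {V : Submodule ℝ (EE n)} (hV : Rat' V) :
    ∃ b : Module.Basis (Fin (Module.finrank ℝ V)) ℝ V, ∀ x : V,
      x ∈ Submodule.span ℤ (range b) ↔ (x : EE n) ∈ LL n := by
  let L : Submodule ℤ V := ZLattice.comap ℝ (LL n) V.subtype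
  have : DiscreteTopology L := ZLattice.comap_discreteTopology ℝ (LL n)
    (LinearMap.continuous_of_finiteDimensional _) V.injective_subtype
  have hspan : Submodule.span ℝ (L : Set V) = ⊤ := by
    apply Submodule.map_injective_of_injective V.injective_subtype
    rw [Submodule.map_span, Submodule.map_top, Submodule.range_subtype]
    have : (V.subtype '' (L : Set V)) = (V : Set (EE n)) ∩ LL n := by
      ext x
      constructor
      · rintro ⟨y, hy, rfl⟩
        exact ⟨y.2, hy⟩
      · rintro ⟨h1, h2⟩
        exact ⟨⟨x, h1⟩, h2, rfl⟩
    rw [this]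
    exact hV
  have : IsZLattice ℝ L := ⟨hspan⟩
  have : Module.Finite ℤ L := ZLattice.module_finite ℝ L
  have : Module.Free ℤ L := ZLattice.module_free ℝ L
  let b := (Module.finBasisOfFinrankEq ℤ L (ZLattice.rank ℝ L)).ofZLatticeBasis ℝ L
  refine ⟨b, fun x => ?_⟩
  rw [Module.Basis.ofZLatticeBasis_span ℝ]
  rfl

def C0 (n : ℕ) : ℝ := n * Real.log 2 + n * Real.log n

theorem finrank_le_n (V : Submodule ℝ (EE n)) : Module.finrank ℝ V ≤ n := by
  have := Submodule.finrank_le V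
  simpa using this

theorem aV_exists (u : EE n) {V : Submodule ℝ (EE n)} (hV : Rat' V) : ∃ a : ℝ, ∀ q z,
    MS u V q (Module.finrank ℝ V) z →
    |(∑ j ∈ Finset.range (Module.finrank ℝ V), Real.log (NN u q (z j))) -
      (a + lam ‖V.orthogonalProjectionOnto u‖ q)| ≤ C0 n := by
  obtain ⟨b, hb⟩ := lattice_basis hV
  obtain ⟨a, ha⟩ := mink_log n (finrank_le_n V) b
  refine ⟨a, fun q z hz => ?_⟩
  have := ha (V.orthogonalProjectionOnto u) q (fun i => ⟨z i, hz.mem i i.2⟩) ?_ ?_ ?_ ?_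
  · simp only [NN_proj] at this
    rw [Fin.sum_univ_eq_sum_range (fun j => Real.log (NN u q (z j)))] at this
    exact this
  · have := sp_li z _ hz.ni
    apply LinearIndependent.of_comp V.subtype
    exact this
  · intro i
    rw [hb]
    exact hz.lat i i.2
  · intro i j hij
    simp only [NN_proj]
    exact hz.mono hij j.2
  · intro j x hx hx'
    simp only [NN_proj]
    refine hz.min j j.2 x x.2 ((hb x).1 hx) ?_
    intro h
    apply hx'
    have : (sp z j) = Submodule.map V.subtype (Submodule.span ℝ
        ((fun i : Fin (Module.finrank ℝ V) => (⟨z i, hz.mem i i.2⟩ : V)) '' Iio j)) := by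
      rw [Submodule.map_span, ← image_comp]
      unfold sp
      congr 1
      ext y
      constructor
      · rintro ⟨i, hi, rfl⟩
        exact ⟨⟨i, lt_trans hi j.2⟩, hi, rfl⟩
      · rintro ⟨i, hi, rfl⟩
        exact ⟨i, hi, rfl⟩
    rw [this] at h
    obtain ⟨y, hy, hyx⟩ := h
    have : y = x := Subtype.ext hyx
    rwa [← this]

theorem C0_nonneg (n : ℕ) : 0 ≤ C0 n := by
  unfold C0
  have := Real.log_natCast_nonneg n
  have := Real.log_nonneg (by norm_num : (1:ℝ) ≤ 2)
  positivity

theorem proj_mono (u : EE n) {V W : Submodule ℝ (EE n)} (h : V ≤ W) :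
    ‖V.orthogonalProjectionOnto u‖ ≤ ‖W.orthogonalProjectionOnto u‖ := by
  set v := V.orthogonalProjectionOnto u
  have h1 : ‖v‖ * ‖v‖ = ⟪(⟨v, h v.2⟩ : W), W.orthogonalProjectionOnto u⟫ := by
    rw [Submodule.inner_orthogonalProjectionOnto_eq_of_mem_left, ← real_inner_self_eq_norm_mul_norm]
    exact Submodule.inner_orthogonalProjectionOnto_eq_of_mem_left v u
  have h2 := real_inner_le_norm (⟨v, h v.2⟩ : W) (W.orthogonalProjectionOnto u)
  have h3 : ‖(⟨v, h v.2⟩ : W)‖ = ‖v‖ := rfl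
  rw [h3, ← h1] at h2
  by_contra! hc
  nlinarith [norm_nonneg (W.orthogonalProjectionOnto u), norm_nonneg v]

theorem proj_top (u : EE n) : ‖(⊤ : Submodule ℝ (EE n)).orthogonalProjectionOnto u‖ = ‖u‖ :=
  Submodule.norm_orthogonalProjectionOnto_apply _ trivial

end Assemble

section Assemble2
variable {n : ℕ}

abbrev RS (n : ℕ) := {V : Submodule ℝ (EE n) // Rat' V}

def aV (u : EE n) (V : RS n) : ℝ := Classical.choose (aV_exists u V.2)

theorem aV_spec (u : EE n) (V : RS n) (q : ℝ) (z : ℕ → EE n)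
    (hz : MS u V.1 q (Module.finrank ℝ V.1) z) :
    |(∑ j ∈ Finset.range (Module.finrank ℝ V.1), Real.log (NN u q (z j))) -
      (aV u V + lam ‖V.1.orthogonalProjectionOnto u‖ q)| ≤ C0 n :=
  Classical.choose_spec (aV_exists u V.2) q z hz

theorem zz_exists (u : EE n) (q : ℝ) : ∃ z, MS u ⊤ q n z :=
  MS_exists u top_rat q n (by simp)

def zz (u : EE n) (q : ℝ) : ℕ → EE n := Classical.choose (zz_exists u q)

theorem zz_spec (u : EE n) (q : ℝ) : MS u ⊤ q n (zz u q) := Classical.choose_spec (zz_exists u q)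

def LLog (u : EE n) (q : ℝ) (j : ℕ) : ℝ := Real.log (NN u q (zz u q (min j (n - 1))))

theorem LLog_eq (u : EE n) (q : ℝ) {j : ℕ} (hj : j < n) :
    LLog u q j = Real.log (NN u q (zz u q j)) := by
  unfold LLog
  rw [min_eq_left (by omega)]

theorem LLog_sum (u : EE n) (q : ℝ) {k : ℕ} (hk : k ≤ n) :
    ∑ j ∈ Finset.range k, LLog u q j = ∑ j ∈ Finset.range k, Real.log (NN u q (zz u q j)) := by
  apply Finset.sum_congr rfl
  intro j hj
  rw [Finset.mem_range] at hj
  exact LLog_eq u q (by omega)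

def FF (u : EE n) (q : ℝ) (k : ℕ) : RS n :=
  ⟨sp (zz u q) (min k n), sp_rat fun j hj => (zz_spec u q).lat j (by omega)⟩

theorem FF_dim (u : EE n) (q : ℝ) {k : ℕ} (hk : k ≤ n) : Module.finrank ℝ (FF u q k).1 = k := by
  have e : (FF u q k).1 = sp (zz u q) k := by
    unfold FF
    dsimp only
    rw [min_eq_left hk]
  rw [e]
  exact sp_finrank _ _ fun i hi => (zz_spec u q).ni i (by omega)

theorem MS_max (u : EE n) (V : RS n) (q : ℝ) : ∃ w, MS u V.1 q (Module.finrank ℝ V.1) w :=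
  MS_exists u V.2 q _ le_rfl

theorem FF_spec (u : EE n) (q : ℝ) {k : ℕ} (hk : k ≤ n) :
    |(∑ j ∈ Finset.range k, LLog u q j) -
      (aV u (FF u q k) + lam ‖(FF u q k).1.orthogonalProjectionOnto u‖ q)| ≤ C0 n := by
  have h := aV_spec u (FF u q k) q (zz u q) ?_
  · rw [FF_dim u q hk] at h
    rw [LLog_sum u q hk]
    exact h
  · rw [FF_dim u q hk]
    have := (zz_spec u q).trunc hk
    unfold FF
    dsimp only
    rw [min_eq_left hk]
    exact this

theorem log_NN_le {u : EE n} {V : Submodule ℝ (EE n)} {q : ℝ} {k : ℕ} {w : ℕ → EE n}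
    (hw : MS u V q k w) {j : ℕ} (hj : j < k) (hjn : j < n) :
    LLog u q j ≤ Real.log (NN u q (w j)) := by
  rw [LLog_eq u q hjn]
  exact Real.log_le_log (by linarith [(zz_spec u q).one_le hjn]) ((zz_spec u q).cmp hw hj hjn)

theorem h2_pf (u : EE n) (V : RS n) (q : ℝ) :
    (∑ j ∈ Finset.range (Module.finrank ℝ V.1), LLog u q j) - C0 n ≤
      aV u V + lam ‖V.1.orthogonalProjectionOnto u‖ q := by
  obtain ⟨w, hw⟩ := MS_max u V q
  have h1 := (abs_le.1 (aV_spec u V q w hw)).2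
  have h2 : ∑ j ∈ Finset.range (Module.finrank ℝ V.1), LLog u q j ≤
      ∑ j ∈ Finset.range (Module.finrank ℝ V.1), Real.log (NN u q (w j)) := by
    apply Finset.sum_le_sum
    intro j hj
    rw [Finset.mem_range] at hj
    exact log_NN_le hw hj (lt_of_lt_of_le hj (finrank_le_n _))
  linarith

theorem h3_pf (u : EE n) (V : RS n) (q : ℝ) (hne : V ≠ FF u q (Module.finrank ℝ V.1)) :
    0 < Module.finrank ℝ V.1 ∧ Module.finrank ℝ V.1 < n ∧
    (∑ j ∈ Finset.range (Module.finrank ℝ V.1), LLog u q j) +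
      (LLog u q (Module.finrank ℝ V.1) - LLog u q (Module.finrank ℝ V.1 - 1)) - C0 n ≤
      aV u V + lam ‖V.1.orthogonalProjectionOnto u‖ q := by
  obtain ⟨w, hw⟩ := MS_max u V q
  have h1 := (abs_le.1 (aV_spec u V q w hw)).2
  obtain ⟨h0, hn, hle⟩ := (zz_spec u q).cmp' hw rfl (finrank_le_n _) (by
    intro h
    apply hne
    apply Subtype.ext
    unfold FF
    dsimp only
    rw [min_eq_left (finrank_le_n _)]
    exact h)
  refine ⟨h0, hn, ?_⟩
  generalize Module.finrank ℝ V.1 = k at *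
  obtain ⟨m, rfl⟩ : ∃ m, k = m + 1 := ⟨k - 1, by omega⟩
  rw [Finset.sum_range_succ] at h1 ⊢
  simp only [Nat.add_sub_cancel] at hle ⊢
  have h2 : ∑ j ∈ Finset.range m, LLog u q j ≤
      ∑ j ∈ Finset.range m, Real.log (NN u q (w j)) := by
    apply Finset.sum_le_sum
    intro j hj
    rw [Finset.mem_range] at hj
    exact log_NN_le hw (by omega) (by omega)
  have h3 : LLog u q (m + 1) ≤ Real.log (NN u q (w m)) := by
    rw [LLog_eq u q hn]
    exact Real.log_le_log (by linarith [(zz_spec u q).one_le hn]) hle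
  linarith

theorem fin_pf (u : EE n) (R : ℝ) : {V : RS n | aV u V ≤ R}.Finite := by
  let T : Set (EE n) := {x : EE n | x ∈ LL n ∧ ‖x‖ ≤ Real.exp (R + lam ‖u‖ 0 + C0 n)}
  have hT : T.Finite := LL_fin _
  have hT2 : ((fun s : Set (EE n) => Submodule.span ℝ s) '' {s | s ⊆ T}).Finite :=
    (hT.finite_subsets).image _
  refine Set.Finite.subset (hT2.preimage (f := (Subtype.val : RS n → _)) Subtype.val_injective.injOn) ?_
  intro V hV
  obtain ⟨w, hw⟩ := MS_max u V 0
  have h1 := (abs_le.1 (aV_spec u V 0 w hw)).2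
  have h2 : lam ‖V.1.orthogonalProjectionOnto u‖ 0 ≤ lam ‖u‖ 0 := 
    lam_mono (norm_nonneg _) (Submodule.norm_orthogonalProjectionOnto_apply_le _ _) le_rfl
  have hV' : aV u V ≤ R := hV
  refine ⟨w '' Iio (Module.finrank ℝ V.1), ?_, ?_⟩
  · rintro _ ⟨i, hi, rfl⟩
    refine ⟨hw.lat i hi, ?_⟩
    have h3 : Real.log (NN u 0 (w i)) ≤
        ∑ j ∈ Finset.range (Module.finrank ℝ V.1), Real.log (NN u 0 (w j)) :=
      Finset.single_le_sum (f := fun j => Real.log (NN u 0 (w j))) (fun j hj =>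
        Real.log_nonneg (hw.one_le (Finset.mem_range.1 hj))) (Finset.mem_range.2 hi)
    have h4 : Real.log (NN u 0 (w i)) ≤ R + lam ‖u‖ 0 + C0 n := by linarith
    rw [Real.log_le_iff_le_exp (by linarith [hw.one_le hi])] at h4
    exact (le_max_left _ _).trans h4
  · exact Submodule.eq_of_le_of_finrank_eq (sp_le hw.mem) (sp_finrank w _ hw.ni)

theorem Lle_pf (hn : 0 < n) (u : EE n) (q q' : ℝ) (j : ℕ) (h : q ≤ q') : LLog u q j ≤ LLog u q' j := by
  unfold LLog
  have hj : min j (n-1) < n := by omega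
  obtain ⟨i, hi, hle⟩ := (zz_spec u q).exch (zz_spec u q') hj
  apply Real.log_le_log (by linarith [(zz_spec u q).one_le hj])
  exact hle.trans ((NN_mono u _ h).trans ((zz_spec u q').mono hi hj))

theorem Llip_pf (hn : 0 < n) (u : EE n) (q q' : ℝ) (j : ℕ) (h : q ≤ q') :
    LLog u q' j ≤ LLog u q j + (q' - q) := by
  unfold LLog
  have hj : min j (n-1) < n := by omega
  obtain ⟨i, hi, hle⟩ := (zz_spec u q').exch (zz_spec u q) hj
  have hp : 0 < NN u q (zz u q (min j (n-1))) := by linarith [(zz_spec u q).one_le hj]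
  have h1 : NN u q' (zz u q' (min j (n-1))) ≤ Real.exp (q' - q) * NN u q (zz u q (min j (n-1))) := by
    refine hle.trans ((NN_lip u _ h).trans ?_)
    gcongr
    exact (zz_spec u q).mono hi hj
  have h2 := Real.log_le_log (by linarith [(zz_spec u q').one_le hj]) h1
  rw [Real.log_mul (Real.exp_pos _).ne' hp.ne', Real.log_exp] at h2
  linarith

def topR : RS n := ⟨⊤, top_rat⟩

theorem Lsum_pf (u : EE n) (hu : u ≠ 0) (q : ℝ) (hq : -Real.log ‖u‖ ≤ q) :
    |(∑ j ∈ Finset.range n, LLog u q j) - q| ≤ C0 n + |aV u topR + Real.log ‖u‖| := by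
  have hr : Module.finrank ℝ (topR (n := n)).1 = n := by
    have : Module.finrank ℝ (⊤ : Submodule ℝ (EE n)) = n := by simp
    exact this
  have h := aV_spec u topR q (zz u q) (by rw [hr]; exact zz_spec u q)
  rw [hr, ← LLog_sum u q le_rfl] at h
  have hp : 0 < ‖u‖ := norm_pos_iff.2 hu
  have h2 : ‖(topR (n := n)).1.orthogonalProjectionOnto u‖ = ‖u‖ := proj_top u
  have h3 : lam ‖u‖ q = Real.log ‖u‖ + q := by
    unfold lam
    rw [max_eq_right, Real.log_mul hp.ne' (Real.exp_pos _).ne', Real.log_exp]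
    have : Real.exp (-Real.log ‖u‖) ≤ Real.exp q := Real.exp_le_exp.2 hq
    rw [Real.exp_neg, Real.exp_log hp] at this
    calc 1 = ‖u‖ * ‖u‖⁻¹ := (mul_inv_cancel₀ hp.ne').symm
      _ ≤ _ := by gcongr
  rw [h2, h3] at h
  calc _ = |((∑ j ∈ Finset.range n, LLog u q j) - (aV u topR + (Real.log ‖u‖ + q))) + 
        (aV u topR + Real.log ‖u‖)| := by congr 1; ring
    _ ≤ _ := (abs_add_le _ _).trans (by linarith)

def theFD (n : ℕ) (hn : 2 ≤ n) (u : EE n) (hu : u ≠ 0) : FD n (RS n) where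
  dim V := Module.finrank ℝ V.1
  a := aV u
  σ V := ‖V.1.orthogonalProjectionOnto u‖
  L := LLog u
  F := FF u
  C := C0 n + |aV u topR + Real.log ‖u‖|
  qs := -Real.log ‖u‖
  hC := add_nonneg (C0_nonneg n) (abs_nonneg _)
  dimF q k hk := FF_dim u q hk
  Fmono q k k' h := sp_mono _ (min_le_min_right _ h)
  dimle V := finrank_le_n _
  h2 V q := by linarith [h2_pf u V q, abs_nonneg (aV u topR + Real.log ‖u‖)]
  h3 V q hne := by
    obtain ⟨h1, h2, h3⟩ := h3_pf u V q hne
    exact ⟨h1, h2, by linarith [abs_nonneg (aV u topR + Real.log ‖u‖)]⟩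
  h4 q k hk := by
    linarith [(abs_le.1 (FF_spec u q hk)).1, abs_nonneg (aV u topR + Real.log ‖u‖)]
  L0 q j := Real.log_nonneg ((zz_spec u q).one_le (by omega))
  Lmono q j j' h := by
    have h1 : min j' (n-1) < n := by omega
    have h2 : min j (n-1) < n := by omega
    exact Real.log_le_log (by linarith [(zz_spec u q).one_le h2])
      ((zz_spec u q).mono (min_le_min_right _ h) h1)
  Lle q q' j h := Lle_pf (by omega) u q q' j h
  Llip q q' j h := Llip_pf (by omega) u q q' j h
  Lsum q hq := Lsum_pf u hu q hq
  σ0 V := norm_nonneg _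
  σmono V W h := proj_mono u h
  fin R := fin_pf u R
  σtop V hV := by
    have e1 : V.1 = ⊤ := Submodule.eq_top_of_finrank_eq (by rw [hV]; simp)
    rw [e1, proj_top, Real.exp_neg, Real.exp_log (norm_pos_iff.2 hu),
      mul_inv_cancel₀ (norm_ne_zero_iff.2 hu)]

theorem Lu_eq (u : EE n) (q : ℝ) (i : Fin n) : Lu n u q i = LLog u q i := by
  unfold Lu
  rw [(zz_spec u q).lamMin_eq i.2, LLog_eq u q i.2]

end Assemble2

theorem stmt_0 (n : ℕ) (hn : 2 ≤ n) (u : EuclideanSpace ℝ (Fin n)) (hu : u ≠ 0)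
    (δ : ℝ) (hδ : 0 < δ) :
    ∃ q₀ : ℝ, (∃ m : ℤ, q₀ = δ * m) ∧ 0 ≤ q₀ ∧
      ∃ P : ℝ → Fin n → ℝ, IsNSystem n (Ici q₀) P ∧ IsRigid n δ q₀ P ∧
        ∃ C : ℝ, ∀ q, q₀ ≤ q → ∀ i, |P q i - Lu n u q i| ≤ C := by
  obtain ⟨P, T0, h1, h2, K, hK⟩ := (theFD n hn u hu).main hn hδ
  refine ⟨δ * T0, ⟨T0, by simp⟩, by positivity, P, h1, h2, K, fun q hq i => ?_⟩
  rw [Lu_eq]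
  exact hK q hq i
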